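/- Let (X,d,m) be an mm-space with m(X) = 1 satisfying CD(K,N) for some K > 0 and N ∈ (1,∞). Then for every bounded Lipschitz function u : X → ℝ with ∫ u dm = 0: ∫ u² dm ≤ ((N−1)/(K·N))·∫ (lip u)² dm. -/

import Mathlib

open MeasureTheory Filter Set Topology ENNReal
open scoped Classical

noncomputable section

/-- A coupling of two measures. -/
def IsCoupling {α β : Type*} [MeasurableSpace α] [MeasurableSpace β]
    (q : Measure (α × β)) (μ : Measure α) (ν : Measure β) : Prop :=
  Measure.map Prod.fst q = μ ∧ Measure.map Prod.snd q = ν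

/-- Membership in the Wasserstein space `P₂`. -/
def MemP2 {α : Type*} [MetricSpace α] [MeasurableSpace α] (μ : Measure α) : Prop :=
  IsProbabilityMeasure μ ∧ ∃ x₀ : α, ∫⁻ x, edist x x₀ ^ 2 ∂μ < ∞

/-- The squared Kantorovich–Wasserstein distance. -/
def Wsq {α : Type*} [MetricSpace α] [MeasurableSpace α] (μ ν : Measure α) : ℝ≥0∞ :=
  ⨅ (q : Measure (α × α)) (_ : IsCoupling q μ ν), ∫⁻ p, edist p.1 p.2 ^ 2 ∂q

/-- The Kantorovich–Wasserstein distance `W₂`. -/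
def W2 {α : Type*} [MetricSpace α] [MeasurableSpace α] (μ ν : Measure α) : ℝ≥0∞ :=
  Wsq μ ν ^ (1/2 : ℝ)

/-- A `W₂`-geodesic parametrized by `[0,1]`. -/
def IsW2Geodesic {α : Type*} [MetricSpace α] [MeasurableSpace α] (μ : ℝ → Measure α) : Prop :=
  ∀ s ∈ Icc (0:ℝ) 1, ∀ t ∈ Icc (0:ℝ) 1,
    W2 (μ s) (μ t) = ENNReal.ofReal |s - t| * W2 (μ 0) (μ 1)

/-- Integrand of the Boltzmann entropy. -/
def entFun {α : Type*} [MeasurableSpace α] (μ m : Measure α) (x : α) : ℝ :=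
  (μ.rnDeriv m x).toReal * Real.log (μ.rnDeriv m x).toReal

/-- Boltzmann entropy `Ent(μ|m)`. -/
def Ent {α : Type*} [MeasurableSpace α] (μ m : Measure α) : EReal :=
  if μ ≪ m ∧ Integrable (fun x => max (entFun μ m x) 0) m then
    ((∫ x, max (entFun μ m x) 0 ∂m : ℝ) : EReal)
      - ((∫⁻ x, ENNReal.ofReal (-(entFun μ m x)) ∂m : ℝ≥0∞) : EReal)
  else ⊤

/-- The CD(K,∞) convexity inequality along some geodesic from `μ₀` to `μ₁`. -/
def CDinftyFor {α : Type*} [MetricSpace α] [MeasurableSpace α]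
    (K : ℝ) (m μ₀ μ₁ : Measure α) : Prop :=
  ∃ μ : ℝ → Measure α, μ 0 = μ₀ ∧ μ 1 = μ₁ ∧ IsW2Geodesic μ ∧
    ∀ t ∈ Icc (0:ℝ) 1,
      Ent (μ t) m ≤ ((1 - t : ℝ) : EReal) * Ent μ₀ m + ((t : ℝ) : EReal) * Ent μ₁ m
        - ((K/2 * (t * (1-t)) : ℝ) : EReal) * ((Wsq μ₀ μ₁ : ℝ≥0∞) : EReal)

/-- The curvature-dimension condition CD(K,∞). -/
def CDinfty {α : Type*} [MetricSpace α] [MeasurableSpace α] (K : ℝ) (m : Measure α) : Prop :=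
  ∀ μ₀ μ₁ : Measure α, MemP2 μ₀ → MemP2 μ₁ → CDinftyFor K m μ₀ μ₁

/-- Distortion coefficients `τ^{(t)}_{K,N}(θ)`. -/
def tauCoef (K N t θ : ℝ) : ℝ≥0∞ :=
  if 0 < K then
    if Real.pi * Real.sqrt ((N-1)/K) ≤ θ then ∞
    else ENNReal.ofReal (t ^ (1/N) *
      (Real.sin (Real.sqrt (K/(N-1)) * (t * θ)) / Real.sin (Real.sqrt (K/(N-1)) * θ)) ^ ((N-1)/N))
  else if K = 0 then ENNReal.ofReal t
  else ENNReal.ofReal (t ^ (1/N) *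
      (Real.sinh (Real.sqrt (-K/(N-1)) * (t * θ)) / Real.sinh (Real.sqrt (-K/(N-1)) * θ)) ^ ((N-1)/N))

/-- The CD(K,N) inequality along some geodesic/optimal coupling from `μ₀` to `μ₁`,
with distortion coefficients `coef`. -/
def CDForWith {α : Type*} [MetricSpace α] [MeasurableSpace α]
    (coef : ℝ → ℝ → ℝ≥0∞) (N : ℝ) (m μ₀ μ₁ : Measure α) : Prop :=
  ∃ (μ : ℝ → Measure α) (q : Measure (α × α)),
    μ 0 = μ₀ ∧ μ 1 = μ₁ ∧ IsW2Geodesic μ ∧ (∀ t ∈ Icc (0:ℝ) 1, μ t ≪ m) ∧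
    IsCoupling q μ₀ μ₁ ∧ (∫⁻ p, edist p.1 p.2 ^ 2 ∂q) = Wsq μ₀ μ₁ ∧
    ∀ t ∈ Icc (0:ℝ) 1,
      ∫⁻ x, ((μ t).rnDeriv m x) ^ (1 - 1/N : ℝ) ∂m ≥
      ∫⁻ p, coef (1-t) (dist p.1 p.2) * (μ₀.rnDeriv m p.1) ^ (-(1/N) : ℝ)
            + coef t (dist p.1 p.2) * (μ₁.rnDeriv m p.2) ^ (-(1/N) : ℝ) ∂q

def CDFor {α : Type*} [MetricSpace α] [MeasurableSpace α]
    (K N : ℝ) (m μ₀ μ₁ : Measure α) : Prop :=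
  CDForWith (fun t θ => tauCoef K N t θ) N m μ₀ μ₁

/-- The curvature-dimension condition CD(K,N). -/
def CD {α : Type*} [MetricSpace α] [MeasurableSpace α] (K N : ℝ) (m : Measure α) : Prop :=
  ∀ μ₀ μ₁ : Measure α, MemP2 μ₀ → MemP2 μ₁ → μ₀ ≪ m → μ₁ ≪ m → CDFor K N m μ₀ μ₁

/-- The support of a measure on a topological space. -/
def mmSupp {α : Type*} [TopologicalSpace α] [MeasurableSpace α] (μ : Measure α) : Set α :=
  {x | ∀ U ∈ nhds x, 0 < μ U}


/-- The local Lipschitz slope `lip u (x) = limsup_{y → x} |u y - u x| / d(x,y)`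
(equal to `0` at isolated points). -/
def lipSlope {α : Type*} [MetricSpace α] (u : α → ℝ) (x : α) : ℝ :=
  Filter.limsup (fun y => |u y - u x| / dist y x) (nhdsWithin x {x}ᶜ)


lemma aux_sin_sub {x : ℝ} (h0 : 0 ≤ x) (h1 : x ≤ Real.pi) :
    0 ≤ Real.sin x - x * Real.cos x := by
  have hm : MonotoneOn (fun x : ℝ => Real.sin x - x * Real.cos x) (Icc 0 Real.pi) := by
    apply monotoneOn_of_deriv_nonneg (convex_Icc _ _)
    · fun_prop
    · fun_prop
    · intro y hy
      rw [interior_Icc] at hy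
      have hd : HasDerivAt (fun x : ℝ => Real.sin x - x * Real.cos x) (y * Real.sin y) y := by
        refine ((Real.hasDerivAt_sin y).sub ((hasDerivAt_id y).mul (Real.hasDerivAt_cos y))).congr_deriv ?_
        simp
      rw [hd.deriv]
      exact mul_nonneg hy.1.le (Real.sin_nonneg_of_nonneg_of_le_pi hy.1.le hy.2.le)
  have := hm (left_mem_Icc.2 Real.pi_pos.le) ⟨h0, h1⟩ h0
  simpa using this

lemma aux_sin_sub2 {x : ℝ} (h0 : 0 ≤ x) (h1 : x ≤ Real.pi) :
    0 ≤ Real.sin x - x * Real.cos x - x ^ 2 * Real.sin x / 3 := by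
  have hm : MonotoneOn (fun x : ℝ => Real.sin x - x * Real.cos x - x ^ 2 * Real.sin x / 3)
      (Icc 0 Real.pi) := by
    apply monotoneOn_of_deriv_nonneg (convex_Icc _ _)
    · fun_prop
    · fun_prop
    · intro y hy
      rw [interior_Icc] at hy
      have hd : HasDerivAt (fun x : ℝ => Real.sin x - x * Real.cos x - x ^ 2 * Real.sin x / 3)
          (y / 3 * (Real.sin y - y * Real.cos y)) y := by
        refine (((Real.hasDerivAt_sin y).sub ((hasDerivAt_id y).mul (Real.hasDerivAt_cos y))).sub
          (((hasDerivAt_pow 2 y).mul (Real.hasDerivAt_sin y)).div_const 3)).congr_deriv ?_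
        simp
        ring
      rw [hd.deriv]
      exact mul_nonneg (by linarith [hy.1]) (aux_sin_sub hy.1.le hy.2.le)
  have := hm (left_mem_Icc.2 Real.pi_pos.le) ⟨h0, h1⟩ h0
  simpa using this

lemma aux_sinc_anti {s x : ℝ} (hs : 0 < s) (hs1 : s ≤ 1) (h0 : 0 < x) (h1 : x < Real.pi) :
    Real.exp ((1 - s ^ 2) * x ^ 2 / 6) ≤ Real.sin (s * x) / (s * Real.sin x) := by
  have hm : AntitoneOn (fun x : ℝ => Real.sin x / x * Real.exp (x ^ 2 / 6)) (Ioc 0 Real.pi) := by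
    have hd : ∀ y ∈ Ioc 0 Real.pi, HasDerivAt (fun x : ℝ => Real.sin x / x * Real.exp (x ^ 2 / 6))
          (- ((Real.sin y - y * Real.cos y - y ^ 2 * Real.sin y / 3) / y ^ 2
            * Real.exp (y ^ 2 / 6))) y := by
      intro y hy
      have hy0 : y ≠ 0 := hy.1.ne'
      refine (((Real.hasDerivAt_sin y).div (hasDerivAt_id y) hy0).mul
          ((hasDerivAt_pow 2 y).div_const 6).exp).congr_deriv ?_
      simp
      field_simp
      ring
    apply antitoneOn_of_deriv_nonpos (convex_Ioc _ _)
    · intro y hy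
      exact (hd y hy).continuousAt.continuousWithinAt
    · intro y hy
      rw [interior_Ioc] at hy
      exact (hd y ⟨hy.1, hy.2.le⟩).differentiableAt.differentiableWithinAt
    · intro y hy
      rw [interior_Ioc] at hy
      rw [(hd y ⟨hy.1, hy.2.le⟩).deriv]
      have := aux_sin_sub2 hy.1.le hy.2.le
      have : 0 ≤ (Real.sin y - y * Real.cos y - y ^ 2 * Real.sin y / 3) / y ^ 2
            * Real.exp (y ^ 2 / 6) := by positivity
      linarith
  have hsx : 0 < s * x := by positivity
  have hle : s * x ≤ x := by nlinarith
  have h := hm ⟨hsx, by linarith⟩ ⟨h0, h1.le⟩ hle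
  have hsin : 0 < Real.sin x := Real.sin_pos_of_pos_of_lt_pi h0 h1
  simp only at h
  have he : Real.exp ((1 - s ^ 2) * x ^ 2 / 6)
      = Real.exp (x ^ 2 / 6) / Real.exp ((s * x) ^ 2 / 6) := by
    rw [← Real.exp_sub]; congr 1; ring
  rw [he, div_le_div_iff₀ (Real.exp_pos _) (by positivity)]
  have h2 : Real.sin x / x * Real.exp (x ^ 2 / 6) * (s * x)
      ≤ Real.sin (s * x) / (s * x) * Real.exp ((s * x) ^ 2 / 6) * (s * x) :=
    mul_le_mul_of_nonneg_right h hsx.le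
  have e1 : Real.sin x / x * Real.exp (x ^ 2 / 6) * (s * x)
    = Real.exp (x ^ 2 / 6) * (s * Real.sin x) := by field_simp
  have e2 : Real.sin (s * x) / (s * x) * Real.exp ((s * x) ^ 2 / 6) * (s * x)
    = Real.sin (s * x) * Real.exp ((s * x) ^ 2 / 6) := by field_simp
  linarith

/-- quadratic lower bound of the distortion coefficients -/
def lowCoef (K N s θ : ℝ) : ℝ := s * (1 + (1 - s ^ 2) * (K / (6 * N)) * θ ^ 2)

lemma lowCoef_nonneg {K N s θ : ℝ} (hK : 0 < K) (hN : 1 < N) (hs : 0 ≤ s) (hs1 : s ≤ 1) :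
    0 ≤ lowCoef K N s θ := by
  unfold lowCoef
  have : 0 ≤ 1 - s ^ 2 := by nlinarith
  have : 0 < N := by linarith
  positivity

lemma tau_lower {K N s θ : ℝ} (hK : 0 < K) (hN : 1 < N) (hs : 0 ≤ s) (hs1 : s ≤ 1) (hθ : 0 < θ) :
    ENNReal.ofReal (lowCoef K N s θ) ≤ tauCoef K N s θ := by
  unfold tauCoef
  rw [if_pos hK]
  split_ifs with h
  · exact le_top
  push Not at h
  rcases hs.eq_or_lt with rfl | hs
  · simp [lowCoef]
  apply ENNReal.ofReal_le_ofReal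
  have hN0 : 0 < N := by linarith
  have hN1 : 0 < N - 1 := by linarith
  set α := Real.sqrt (K / (N - 1)) with hα
  have hα0 : 0 < α := Real.sqrt_pos.2 (by positivity)
  have hα2 : α ^ 2 = K / (N - 1) := Real.sq_sqrt (by positivity)
  have hx1 : α * θ < Real.pi := by
    have : Real.sqrt ((N - 1) / K) = α⁻¹ := by
      rw [hα, ← Real.sqrt_inv, inv_div]
    rw [this, ← div_eq_mul_inv, lt_div_iff₀ hα0] at h
    linarith
  have hx0 : 0 < α * θ := by positivity
  have key := aux_sinc_anti hs hs1 hx0 hx1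
  have hsin : 0 < Real.sin (α * θ) := Real.sin_pos_of_pos_of_lt_pi hx0 hx1
  have e1 : Real.sin (α * (s * θ)) / Real.sin (α * θ)
      = s * (Real.sin (s * (α * θ)) / (s * Real.sin (α * θ))) := by
    rw [show α * (s * θ) = s * (α * θ) by ring]; field_simp
  have ha : 0 ≤ (N - 1) / N := by positivity
  rw [e1, Real.mul_rpow hs.le (le_trans (Real.exp_pos _).le key), ← mul_assoc,
    ← Real.rpow_add hs, show 1 / N + (N - 1) / N = 1 by field_simp; ring, Real.rpow_one]
  unfold lowCoef
  apply mul_le_mul_of_nonneg_left _ hs.le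
  calc 1 + (1 - s ^ 2) * (K / (6 * N)) * θ ^ 2
      = ((1 - s ^ 2) * (α * θ) ^ 2 / 6) * ((N - 1) / N) + 1 := by
        rw [mul_pow, hα2]; field_simp; ring
    _ ≤ Real.exp (((1 - s ^ 2) * (α * θ) ^ 2 / 6) * ((N - 1) / N)) := Real.add_one_le_exp _
    _ = Real.exp ((1 - s ^ 2) * (α * θ) ^ 2 / 6) ^ ((N - 1) / N) := by rw [Real.exp_mul]
    _ ≤ _ := Real.rpow_le_rpow (Real.exp_pos _).le key ha

set_option linter.unusedSectionVars false
set_option linter.unusedSimpArgs false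

section coupling
variable {α : Type*} [MetricSpace α] [MeasurableSpace α]

lemma IsCoupling.prob {q : Measure (α × α)} {μ ν : Measure α} (h : IsCoupling q μ ν)
    [IsProbabilityMeasure μ] : IsProbabilityMeasure q := by
  constructor
  have h1 : Measure.map Prod.fst q univ = 1 := by rw [h.1]; exact measure_univ
  rwa [Measure.map_apply measurable_fst MeasurableSet.univ, preimage_univ] at h1

lemma IsCoupling.prob_right {q : Measure (α × α)} {μ ν : Measure α} (h : IsCoupling q μ ν)
    [IsProbabilityMeasure μ] : IsProbabilityMeasure ν := by
  have := h.prob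
  rw [← h.2]
  exact Measure.isProbabilityMeasure_map measurable_snd.aemeasurable

lemma Wsq_le {q : Measure (α × α)} {μ ν : Measure α} (h : IsCoupling q μ ν) :
    Wsq μ ν ≤ ∫⁻ p, edist p.1 p.2 ^ 2 ∂q := iInf₂_le q h

lemma exists_coupling {μ ν : Measure α} (h : Wsq μ ν ≠ ∞) :
    ∃ q : Measure (α × α), IsCoupling q μ ν := by
  by_contra hc
  push Not at hc
  apply h
  unfold Wsq
  simp [hc]

lemma geod_Wsq {μ : ℝ → Measure α} (h : IsW2Geodesic μ) {s t : ℝ} (hs : s ∈ Icc (0:ℝ) 1)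
    (ht : t ∈ Icc (0:ℝ) 1) :
    Wsq (μ s) (μ t) = ENNReal.ofReal (|s - t| ^ 2) * Wsq (μ 0) (μ 1) := by
  have h1 := h s hs t ht
  unfold W2 at h1
  have h2 := congrArg (fun x : ℝ≥0∞ => x ^ (2:ℝ)) h1
  rw [ENNReal.mul_rpow_of_nonneg _ _ (by norm_num), ← ENNReal.rpow_mul, ← ENNReal.rpow_mul] at h2
  norm_num at h2
  rw [h2, ENNReal.ofReal_pow (abs_nonneg _)]

lemma isCoupling_prod (μ ν : Measure α) [IsProbabilityMeasure μ] [IsProbabilityMeasure ν] :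
    IsCoupling (μ.prod ν) μ ν := by
  constructor <;> simp

lemma memP2_of_bdd {m μ : Measure α} {x₀ : α} {R : ℝ} (hR : ∀ᵐ x ∂m, dist x x₀ ≤ R)
    (hμ : μ ≪ m) [IsProbabilityMeasure μ] : MemP2 μ := by
  refine ⟨inferInstance, x₀, ?_⟩
  calc ∫⁻ x, edist x x₀ ^ 2 ∂μ ≤ ∫⁻ x, ENNReal.ofReal R ^ 2 ∂μ := by
        apply lintegral_mono_ae
        filter_upwards [hμ.ae_le hR] with x hx
        gcongr
        rw [edist_dist]
        exact ENNReal.ofReal_le_ofReal hx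
    _ < ∞ := by simp [ENNReal.pow_lt_top]

lemma Wsq_ne_top {m μ ν : Measure α} {x₀ : α} {R : ℝ} (hR : ∀ᵐ x ∂m, dist x x₀ ≤ R)
    (hμ : μ ≪ m) [IsProbabilityMeasure μ] (hν : ν ≪ m) [IsProbabilityMeasure ν] :
    Wsq μ ν ≠ ∞ := by
  apply ne_top_of_le_ne_top _ (Wsq_le (isCoupling_prod μ ν))
  apply ne_of_lt
  have h1 : ∀ᵐ p ∂(μ.prod ν), dist p.1 x₀ ≤ R :=
    Measure.quasiMeasurePreserving_fst.ae (hμ.ae_le hR)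
  have h2 : ∀ᵐ p ∂(μ.prod ν), dist p.2 x₀ ≤ R :=
    Measure.quasiMeasurePreserving_snd.ae (hν.ae_le hR)
  calc ∫⁻ p, edist p.1 p.2 ^ 2 ∂(μ.prod ν) ≤ ∫⁻ p, ENNReal.ofReal (R + R) ^ 2 ∂(μ.prod ν) := by
        apply lintegral_mono_ae
        filter_upwards [h1, h2] with p hp1 hp2
        gcongr
        rw [edist_dist]
        apply ENNReal.ofReal_le_ofReal
        have := dist_triangle_right p.1 p.2 x₀
        linarith
    _ < ∞ := by simp [ENNReal.pow_lt_top]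

lemma IsCoupling.add {q q' : Measure (α × α)} {μ ν μ' ν' : Measure α} (h : IsCoupling q μ ν)
    (h' : IsCoupling q' μ' ν') : IsCoupling (q + q') (μ + μ') (ν + ν') := by
  constructor
  · rw [Measure.map_add _ _ measurable_fst, h.1, h'.1]
  · rw [Measure.map_add _ _ measurable_snd, h.2, h'.2]

lemma IsCoupling.smul {q : Measure (α × α)} {μ ν : Measure α} (h : IsCoupling q μ ν)
    (c : ℝ≥0∞) : IsCoupling (c • q) (c • μ) (c • ν) := by
  constructor
  · rw [Measure.map_smul, h.1]
  · rw [Measure.map_smul, h.2]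

/-- push-forward under the diagonal map -/
def diagM (η : Measure α) : Measure (α × α) := η.map (fun x => (x, x))

lemma meas_diag : Measurable (fun x : α => (x, x)) := measurable_id.prodMk measurable_id

lemma isCoupling_diagM (η : Measure α) : IsCoupling (diagM η) η η := by
  unfold diagM
  constructor
  · rw [Measure.map_map measurable_fst meas_diag]; exact Measure.map_id
  · rw [Measure.map_map measurable_snd meas_diag]; exact Measure.map_id

variable [SecondCountableTopology α] [BorelSpace α]

lemma meas_cost : Measurable (fun p : α × α => edist p.1 p.2 ^ 2) :=
  (measurable_fst.edist measurable_snd).pow_const 2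

lemma cost_diagM (η : Measure α) : ∫⁻ p, edist p.1 p.2 ^ 2 ∂(diagM η) = 0 := by
  unfold diagM
  rw [lintegral_map meas_cost meas_diag]
  simp

lemma meas_D : MeasurableSet {p : α × α | p.1 = p.2} :=
  measurableSet_eq_fun measurable_fst measurable_snd

lemma lintegral_diagM (η : Measure α) {f : α × α → ℝ≥0∞} (hf : Measurable f) :
    ∫⁻ p, f p ∂(diagM η) = ∫⁻ x, f (x, x) ∂η := by
  unfold diagM
  rw [lintegral_map hf meas_diag]

end coupling

lemma jensen_rpow {α : Type*} [MeasurableSpace α] {m : Measure α} [IsProbabilityMeasure m]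
    {f : α → ℝ≥0∞} (hf : AEMeasurable f m) {a : ℝ} (ha0 : 0 < a) (ha1 : a ≤ 1) :
    ∫⁻ x, f x ^ a ∂m ≤ (∫⁻ x, f x ∂m) ^ a := by
  have h := eLpNorm'_le_eLpNorm'_of_exponent_le (f := f) ha0 ha1 m hf.aestronglyMeasurable
  simp only [eLpNorm', enorm_eq_self, ENNReal.rpow_one, div_one] at h
  have h2 := ENNReal.rpow_le_rpow h ha0.le
  rwa [← ENNReal.rpow_mul, one_div_mul_cancel ha0.ne', ENNReal.rpow_one] at h2

lemma ac_of_coupling {α : Type*} [MeasurableSpace α] {q : Measure (α × α)} {μ ν : Measure α}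
    (h : IsCoupling q μ ν) {P : α → Prop} (hP : ∀ᵐ x ∂μ, P x) : ∀ᵐ p ∂q, P p.1 := by
  rw [← h.1] at hP
  exact ae_of_ae_map measurable_fst.aemeasurable hP

lemma ac_of_coupling' {α : Type*} [MeasurableSpace α] {q : Measure (α × α)} {μ ν : Measure α}
    (h : IsCoupling q μ ν) {P : α → Prop} (hP : ∀ᵐ x ∂ν, P x) : ∀ᵐ p ∂q, P p.2 := by
  rw [← h.2] at hP
  exact ae_of_ae_map measurable_snd.aemeasurable hP

lemma CD_bdd {X : Type*} [MetricSpace X] [SecondCountableTopology X]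
    [MeasurableSpace X] [BorelSpace X] (m : Measure X) [IsProbabilityMeasure m]
    (K N : ℝ) (hK : 0 < K) (hN : 1 < N) (hCD : CD K N m) :
    ∃ (x₀ : X) (R : ℝ), ∀ᵐ x ∂m, dist x x₀ ≤ R := by
  have hne : Nonempty X := by
    by_contra h
    rw [not_nonempty_iff] at h
    have : m univ = 1 := measure_univ
    rw [univ_eq_empty_iff.2 h] at this
    simp at this
  obtain ⟨x₀⟩ := hne
  refine ⟨x₀, ?_⟩
  set D := Real.pi * Real.sqrt ((N-1)/K) with hD
  obtain ⟨n, hn⟩ : ∃ n : ℕ, m (Metric.ball x₀ n) ≠ 0 := by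
    by_contra hc
    push Not at hc
    have := measure_iUnion_null hc
    rw [Metric.iUnion_ball_nat] at this
    simp at this
  refine ⟨n + D, ?_⟩
  by_contra hc
  have hc' : m {x | ¬ dist x x₀ ≤ n + D} ≠ 0 := hc
  obtain ⟨k, hk⟩ : ∃ k : ℕ, m ({x | ¬ dist x x₀ ≤ n + D} ∩ Metric.ball x₀ k) ≠ 0 := by
    by_contra hc
    have hc : ∀ k : ℕ, m ({x | ¬ dist x x₀ ≤ n + D} ∩ Metric.ball x₀ k) = 0 := by
      simpa using hc
    have := measure_iUnion_null hc
    rw [← inter_iUnion, Metric.iUnion_ball_nat, inter_univ] at this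
    exact hc' this
  set B := Metric.ball x₀ (n:ℝ)
  set A := {x | ¬ dist x x₀ ≤ n + D} ∩ Metric.ball x₀ (k:ℝ)
  have hBm : MeasurableSet B := measurableSet_ball
  have hAm : MeasurableSet A := by
    apply MeasurableSet.inter _ measurableSet_ball
    exact (measurableSet_le (measurable_id.dist measurable_const) measurable_const).compl
  set μ₀ := ProbabilityTheory.cond m B
  set μ₁ := ProbabilityTheory.cond m A
  have p0 : IsProbabilityMeasure μ₀ := ProbabilityTheory.cond_isProbabilityMeasure hn
  have p1 : IsProbabilityMeasure μ₁ := ProbabilityTheory.cond_isProbabilityMeasure hk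
  have ac0 : μ₀ ≪ m := ProbabilityTheory.cond_absolutelyContinuous
  have ac1 : μ₁ ≪ m := ProbabilityTheory.cond_absolutelyContinuous
  have hB : ∀ᵐ x ∂μ₀, x ∈ B := ProbabilityTheory.ae_cond_mem hBm
  have hA : ∀ᵐ x ∂μ₁, x ∈ A := ProbabilityTheory.ae_cond_mem hAm
  have hB' : ∀ᵐ x ∂μ₀, dist x x₀ ≤ n := by
    filter_upwards [hB] with x hx using (Metric.mem_ball.1 hx).le
  have hA' : ∀ᵐ x ∂μ₁, dist x x₀ ≤ k := by
    filter_upwards [hA] with x hx using (Metric.mem_ball.1 hx.2).le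
  have hsum : ∀ᵐ x ∂(μ₀ + μ₁), dist x x₀ ≤ max (n:ℝ) (k:ℝ) := by
    rw [ae_add_measure_iff]
    constructor
    · filter_upwards [hB'] with x hx using le_max_of_le_left hx
    · filter_upwards [hA'] with x hx using le_max_of_le_right hx
  have hW : Wsq μ₀ μ₁ ≠ ∞ := Wsq_ne_top hsum
    (Measure.absolutelyContinuous_of_le (Measure.le_add_right le_rfl))
    (Measure.absolutelyContinuous_of_le (Measure.le_add_left le_rfl))
  obtain ⟨μ, q, h0, h1, hg, hac, hq, -, hin⟩ :=
    hCD μ₀ μ₁ (memP2_of_bdd hB' Measure.AbsolutelyContinuous.rfl)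
      (memP2_of_bdd hA' Measure.AbsolutelyContinuous.rfl) ac0 ac1
  have hh : (1/2 : ℝ) ∈ Icc (0:ℝ) 1 := by constructor <;> norm_num
  have hin := hin (1/2) hh
  have pt : IsProbabilityMeasure (μ (1/2)) := by
    have := geod_Wsq hg (left_mem_Icc.2 zero_le_one) hh
    rw [h0, h1] at this
    obtain ⟨q', hq'⟩ := exists_coupling (μ := μ₀) (ν := μ (1/2))
      (by rw [this]; exact ENNReal.mul_ne_top ENNReal.ofReal_ne_top hW)
    exact hq'.prob_right
  have hqp := hq.prob
  have hN1 : (0:ℝ) < 1 - 1/N := by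
    have : 1 / N < 1 := by rw [div_lt_one (by linarith)]; exact hN
    linarith
  have hl : ∫⁻ x, ((μ (1/2)).rnDeriv m x) ^ (1 - 1/N : ℝ) ∂m ≤ 1 := by
    refine (jensen_rpow (Measure.measurable_rnDeriv _ _).aemeasurable hN1
      (by have : 0 < 1 / N := by positivity
          linarith)).trans ?_
    apply ENNReal.rpow_le_one _ hN1.le
    exact (Measure.lintegral_rnDeriv_le).trans measure_univ.le
  have hr : ∫⁻ p, tauCoef K N (1-1/2) (dist p.1 p.2) * (μ₀.rnDeriv m p.1) ^ (-(1/N) : ℝ)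
            + tauCoef K N (1/2) (dist p.1 p.2) * (μ₁.rnDeriv m p.2) ^ (-(1/N) : ℝ) ∂q
      = ∫⁻ p, ∞ ∂q := by
    apply lintegral_congr_ae
    have hfin : ∀ᵐ x ∂μ₀, μ₀.rnDeriv m x < ∞ := ac0.ae_le (Measure.rnDeriv_lt_top μ₀ m)
    filter_upwards [ac_of_coupling hq hB, ac_of_coupling' hq hA, ac_of_coupling hq hfin]
      with p hp1 hp2 hp3
    have hd : D ≤ dist p.1 p.2 := by
      have a1 : dist p.1 x₀ < n := hp1
      have a2 : ¬ dist p.2 x₀ ≤ n + D := hp2.1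
      push Not at a2
      have := dist_triangle_left p.2 x₀ p.1
      linarith
    have : tauCoef K N (1-1/2) (dist p.1 p.2) = ∞ := by
      unfold tauCoef
      rw [if_pos hK, if_pos hd]
    rw [this, ENNReal.top_mul, top_add]
    rw [ENNReal.rpow_neg]
    simp only [ne_eq, ENNReal.inv_eq_zero]
    exact ENNReal.rpow_ne_top_of_nonneg (by positivity) hp3.ne
  rw [ge_iff_le, hr] at hin
  have hin2 := hin.trans hl
  simp at hin2

lemma glue {X : Type*} [MetricSpace X] [CompleteSpace X] [SecondCountableTopology X]
    [MeasurableSpace X] [BorelSpace X] {π₁ π₂ : Measure (X × X)} {μ σ ν : Measure X}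
    [IsProbabilityMeasure μ] [IsProbabilityMeasure σ]
    (h₁ : IsCoupling π₁ μ σ) (h₂ : IsCoupling π₂ σ ν) :
    ∃ P : Measure (X × X × X), P.map (fun w => (w.2.1, w.1)) = π₁ ∧
      P.map (fun w => (w.1, w.2.2)) = π₂ := by
  have p1 := h₁.prob
  have p2 := h₂.prob
  have hne : Nonempty X := by
    by_contra h
    rw [not_nonempty_iff] at h
    have : μ univ = 1 := measure_univ
    rw [univ_eq_empty_iff.2 h] at this
    simp at this
  set π₁' := π₁.map Prod.swap with hπ
  have p1' : IsProbabilityMeasure π₁' :=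
    Measure.isProbabilityMeasure_map measurable_swap.aemeasurable
  have f1 : π₁'.fst = σ := by
    rw [Measure.fst, hπ, Measure.map_map measurable_fst measurable_swap]
    exact h₁.2
  have f2 : π₂.fst = σ := h₂.1
  have d1 : Measure.compProd σ π₁'.condKernel = π₁' := by
    conv_rhs => rw [← π₁'.disintegrate π₁'.condKernel, f1]
  have d2 : Measure.compProd σ π₂.condKernel = π₂ := by
    conv_rhs => rw [← π₂.disintegrate π₂.condKernel, f2]
  refine ⟨Measure.compProd σ (ProbabilityTheory.Kernel.prod π₁'.condKernel π₂.condKernel), ?_, ?_⟩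
  · have e : (Measure.compProd σ (ProbabilityTheory.Kernel.prod π₁'.condKernel π₂.condKernel)).map
        (Prod.map id Prod.fst) = π₁' := by
      rw [← Measure.compProd_map measurable_fst, ← ProbabilityTheory.Kernel.fst_eq,
        ProbabilityTheory.Kernel.fst_prod, d1]
    have e2 : π₁ = π₁'.map Prod.swap := by
      rw [hπ, Measure.map_map measurable_swap measurable_swap]
      simp
    have e3 := congrArg (Measure.map Prod.swap) e
    rw [Measure.map_map measurable_swap (measurable_id.prodMap measurable_fst)] at e3
    exact e3.trans e2.symm
  · have e : (Measure.compProd σ (ProbabilityTheory.Kernel.prod π₁'.condKernel π₂.condKernel)).map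
        (Prod.map id Prod.snd) = π₂ := by
      rw [← Measure.compProd_map measurable_snd, ← ProbabilityTheory.Kernel.snd_eq,
        ProbabilityTheory.Kernel.snd_prod, d2]
    exact e

lemma sq_split {a b t : ℝ} (ht0 : 0 < t) (ht1 : t < 1) :
    (a + b) ^ 2 ≤ a ^ 2 / t + b ^ 2 / (1 - t) := by
  have h1 : 0 < 1 - t := by linarith
  rw [div_add_div _ _ ht0.ne' h1.ne', le_div_iff₀ (by positivity)]
  nlinarith [sq_nonneg (a * (1 - t) - b * t)]

lemma edist_sq_split {X : Type*} [MetricSpace X] (x y z : X) {t : ℝ} (ht0 : 0 < t) (ht1 : t < 1) :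
    edist y z ^ 2 ≤ ENNReal.ofReal (dist y x ^ 2 / t + dist x z ^ 2 / (1 - t)) := by
  rw [edist_dist, ← ENNReal.ofReal_pow dist_nonneg]
  apply ENNReal.ofReal_le_ofReal
  refine le_trans ?_ (sq_split ht0 ht1)
  gcongr
  exact dist_triangle _ _ _

lemma edist_sq {X : Type*} [MetricSpace X] (x y : X) :
    edist x y ^ 2 = ENNReal.ofReal (dist x y ^ 2) := by
  rw [edist_dist, ← ENNReal.ofReal_pow dist_nonneg]

lemma lintegral_A {X : Type*} [MetricSpace X] [SecondCountableTopology X]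
    [MeasurableSpace X] [BorelSpace X] {P : Measure (X × X × X)} {Q : ℝ≥0∞}
    {t : ℝ} (ht0 : 0 < t) (ht1 : t < 1)
    (hy : ∫⁻ w, edist w.2.1 w.1 ^ 2 ∂P ≤ ENNReal.ofReal (t ^ 2) * Q)
    (hz : ∫⁻ w, edist w.1 w.2.2 ^ 2 ∂P ≤ ENNReal.ofReal ((1 - t) ^ 2) * Q) :
    ∫⁻ w, ENNReal.ofReal (dist w.2.1 w.1 ^ 2 / t + dist w.1 w.2.2 ^ 2 / (1 - t)) ∂P ≤ Q := by
  have h1 : 0 < 1 - t := by linarith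
  have e : ∀ w : X × X × X,
      ENNReal.ofReal (dist w.2.1 w.1 ^ 2 / t + dist w.1 w.2.2 ^ 2 / (1 - t))
      = ENNReal.ofReal t⁻¹ * edist w.2.1 w.1 ^ 2
        + ENNReal.ofReal (1 - t)⁻¹ * edist w.1 w.2.2 ^ 2 := by
    intro w
    rw [edist_sq, edist_sq, ← ENNReal.ofReal_mul (by positivity),
      ← ENNReal.ofReal_mul (by positivity), ← ENNReal.ofReal_add (by positivity) (by positivity)]
    congr 1
    field_simp
  have m1 : Measurable (fun w : X × X × X => edist w.2.1 w.1 ^ 2) :=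
    (measurable_snd.fst.edist measurable_fst).pow_const 2
  have m2 : Measurable (fun w : X × X × X => edist w.1 w.2.2 ^ 2) :=
    (measurable_fst.edist measurable_snd.snd).pow_const 2
  simp_rw [e]
  rw [lintegral_add_left (m1.const_mul _), lintegral_const_mul _ m1, lintegral_const_mul _ m2]
  calc _ ≤ ENNReal.ofReal t⁻¹ * (ENNReal.ofReal (t ^ 2) * Q)
        + ENNReal.ofReal (1 - t)⁻¹ * (ENNReal.ofReal ((1 - t) ^ 2) * Q) := by gcongr
    _ = Q := by
      rw [← mul_assoc, ← mul_assoc, ← ENNReal.ofReal_mul (by positivity),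
        ← ENNReal.ofReal_mul (by positivity), ← add_mul,
        ← ENNReal.ofReal_add (by positivity) (by positivity)]
      have : t⁻¹ * t ^ 2 + (1 - t)⁻¹ * (1 - t) ^ 2 = 1 := by field_simp; ring
      rw [this]; simp

lemma swap_lemma {X : Type*} [MetricSpace X] [SecondCountableTopology X]
    [MeasurableSpace X] [BorelSpace X] {P : Measure (X × X × X)} [IsFiniteMeasure P]
    {η : Measure X} {f : X → ℝ≥0∞} (hf : Measurable f) (hf1 : ∀ x, f x ≤ 1)
    (hη : (P.map (fun w => w.1)).withDensity f ≤ η) {Q : ℝ≥0∞} (hQ : Q ≠ ∞)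
    (hQW : Q ≤ Wsq (η + P.map (fun w => w.2.1)) (η + P.map (fun w => w.2.2)))
    {t : ℝ} (ht0 : 0 < t) (ht1 : t < 1)
    (hy : ∫⁻ w, edist w.2.1 w.1 ^ 2 ∂P ≤ ENNReal.ofReal (t ^ 2) * Q)
    (hz : ∫⁻ w, edist w.1 w.2.2 ^ 2 ∂P ≤ ENNReal.ofReal ((1 - t) ^ 2) * Q) :
    ∀ᵐ w ∂P, f w.1 ≠ 0 → w.2.1 = w.2.2 := by
  have h1 : 0 < 1 - t := by linarith
  have hA := lintegral_A ht0 ht1 hy hz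
  have mx : Measurable (fun w : X × X × X => w.1) := measurable_fst
  have my : Measurable (fun w : X × X × X => w.2.1) := measurable_snd.fst
  have mz : Measurable (fun w : X × X × X => w.2.2) := measurable_snd.snd
  have mfx : Measurable (fun w : X × X × X => f w.1) := hf.comp mx
  have m1fx : Measurable (fun w : X × X × X => 1 - f w.1) := measurable_const.sub mfx
  set σ := (P.map (fun w => w.1)).withDensity f with hσ
  have hσP : σ = (P.withDensity (fun w => f w.1)).map (fun w => w.1) := by
    ext s hs
    rw [hσ, withDensity_apply _ hs, Measure.map_apply mx hs, withDensity_apply _ (mx hs),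
      setLIntegral_map hs hf mx]
  have fP1 : IsFiniteMeasure (P.map (fun w => w.1)) := inferInstance
  have fσ : IsFiniteMeasure σ := by
    rw [hσ]
    apply isFiniteMeasure_withDensity
    apply ne_of_lt
    calc ∫⁻ x, f x ∂(P.map (fun w => w.1)) ≤ ∫⁻ x, 1 ∂(P.map (fun w => w.1)) := by
          apply lintegral_mono; exact hf1
      _ < ∞ := by simp [measure_lt_top]
  set P1 := P.withDensity (fun w => 1 - f w.1) with hP1
  set P2 := P.withDensity (fun w => f w.1) with hP2
  have hPsum : P1 + P2 = P := by
    rw [hP1, hP2, ← withDensity_add_left m1fx]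
    conv_rhs => rw [← withDensity_one (μ := P)]
    congr 1
    funext w
    simp [tsub_add_cancel_of_le (hf1 w.1)]
  have myz : Measurable (fun w : X × X × X => (w.2.1, w.2.2)) := my.prodMk mz
  have myx : Measurable (fun w : X × X × X => (w.2.1, w.1)) := my.prodMk mx
  have mxz : Measurable (fun w : X × X × X => (w.1, w.2.2)) := mx.prodMk mz
  have hsub : η - σ + σ = η := Measure.sub_add_cancel_of_le hη
  set q := diagM (η - σ) + (P1.map (fun w => (w.2.1, w.2.2)) + (P2.map (fun w => (w.2.1, w.1))
    + P2.map (fun w => (w.1, w.2.2)))) with hq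
  have hc : IsCoupling q (η + P.map (fun w => w.2.1)) (η + P.map (fun w => w.2.2)) := by
    have c1 := isCoupling_diagM (η - σ)
    constructor
    · rw [hq, Measure.map_add _ _ measurable_fst, Measure.map_add _ _ measurable_fst,
        Measure.map_add _ _ measurable_fst, c1.1, Measure.map_map measurable_fst myz,
        Measure.map_map measurable_fst myx, Measure.map_map measurable_fst mxz]
      change η - σ + (P1.map (fun w => w.2.1) + (P2.map (fun w => w.2.1)
        + P2.map (fun w => w.1))) = _
      rw [← hσP]
      have hm : P.map (fun w => w.2.1) = P1.map (fun w => w.2.1) + P2.map (fun w => w.2.1) := by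
        rw [← Measure.map_add _ _ my, hPsum]
      rw [hm]
      nth_rewrite 2 [← hsub]
      generalize η - σ = ζ
      abel
    · rw [hq, Measure.map_add _ _ measurable_snd, Measure.map_add _ _ measurable_snd,
        Measure.map_add _ _ measurable_snd, c1.2, Measure.map_map measurable_snd myz,
        Measure.map_map measurable_snd myx, Measure.map_map measurable_snd mxz]
      change η - σ + (P1.map (fun w => w.2.2) + (P2.map (fun w => w.1)
        + P2.map (fun w => w.2.2))) = _
      rw [← hσP]
      have hm : P.map (fun w => w.2.2) = P1.map (fun w => w.2.2) + P2.map (fun w => w.2.2) := by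
        rw [← Measure.map_add _ _ mz, hPsum]
      rw [hm]
      nth_rewrite 2 [← hsub]
      generalize η - σ = ζ
      abel
  set A : X × X × X → ℝ≥0∞ :=
    fun w => ENNReal.ofReal (dist w.2.1 w.1 ^ 2 / t + dist w.1 w.2.2 ^ 2 / (1 - t)) with hAdef
  set B : X × X × X → ℝ≥0∞ :=
    fun w => ENNReal.ofReal (dist w.2.1 w.1 ^ 2 + dist w.1 w.2.2 ^ 2) with hBdef
  have mA : Measurable A := by
    apply Measurable.ennreal_ofReal
    exact (((my.dist mx).pow_const 2).div_const t).add (((mx.dist mz).pow_const 2).div_const (1-t))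
  have mB : Measurable B := by
    apply Measurable.ennreal_ofReal
    exact ((my.dist mx).pow_const 2).add ((mx.dist mz).pow_const 2)
  have hBA : ∀ w, B w ≤ A w := by
    intro w
    apply ENNReal.ofReal_le_ofReal
    have a1 : dist w.2.1 w.1 ^ 2 ≤ dist w.2.1 w.1 ^ 2 / t := by
      rw [le_div_iff₀ ht0]; nlinarith [sq_nonneg (dist w.2.1 w.1)]
    have a2 : dist w.1 w.2.2 ^ 2 ≤ dist w.1 w.2.2 ^ 2 / (1 - t) := by
      rw [le_div_iff₀ h1]; nlinarith [sq_nonneg (dist w.1 w.2.2)]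
    linarith
  have mcyz : Measurable (fun w : X × X × X => edist w.2.1 w.2.2 ^ 2) := meas_cost.comp myz
  have mcyx : Measurable (fun w : X × X × X => edist w.2.1 w.1 ^ 2) := meas_cost.comp myx
  have mcxz : Measurable (fun w : X × X × X => edist w.1 w.2.2 ^ 2) := meas_cost.comp mxz
  have hcost : ∫⁻ p, edist p.1 p.2 ^ 2 ∂q ≤ ∫⁻ w, ((1 - f w.1) * A w + f w.1 * B w) ∂P := by
    rw [hq, lintegral_add_measure, lintegral_add_measure, lintegral_add_measure, cost_diagM,
      lintegral_map meas_cost myz, lintegral_map meas_cost myx, lintegral_map meas_cost mxz,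
      zero_add, ← lintegral_add_left mcyx]
    have mprod : Measurable (fun w : X × X × X => (1 - f w.1) * A w) := m1fx.mul mA
    rw [lintegral_add_left mprod]
    apply add_le_add
    · rw [hP1, lintegral_withDensity_eq_lintegral_mul _ m1fx mcyz]
      apply lintegral_mono
      intro w
      simp only [Pi.mul_apply]
      gcongr
      exact edist_sq_split _ _ _ ht0 ht1
    · have msum : Measurable (fun w : X × X × X => edist w.2.1 w.1 ^ 2 + edist w.1 w.2.2 ^ 2) :=
        mcyx.add mcxz
      change ∫⁻ w, (edist w.2.1 w.1 ^ 2 + edist w.1 w.2.2 ^ 2) ∂P2 ≤ _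
      rw [hP2, lintegral_withDensity_eq_lintegral_mul _ mfx msum]
      apply lintegral_mono
      intro w
      simp only [Pi.mul_apply, Pi.add_apply, hBdef]
      rw [edist_sq, edist_sq, ← ENNReal.ofReal_add (by positivity) (by positivity)]
  have hCA : ∀ w, (1 - f w.1) * A w + f w.1 * B w ≤ A w := by
    intro w
    calc (1 - f w.1) * A w + f w.1 * B w ≤ (1 - f w.1) * A w + f w.1 * A w := by
          gcongr; exact hBA w
      _ = A w := by rw [← add_mul, tsub_add_cancel_of_le (hf1 _), one_mul]
  have hae := ae_eq_of_ae_le_of_lintegral_le (μ := P) (ae_of_all _ hCA)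
    (ne_top_of_le_ne_top hQ ((lintegral_mono hCA).trans hA)) mA.aemeasurable
    (hA.trans (hQW.trans ((Wsq_le hc).trans hcost)))
  filter_upwards [hae] with w hw hfw
  have hfin : A w ≠ ∞ := ENNReal.ofReal_ne_top
  have e : (1 - f w.1) * A w + f w.1 * B w = (1 - f w.1) * A w + f w.1 * A w := by
    rw [hw, ← add_mul, tsub_add_cancel_of_le (hf1 _), one_mul]
  have hf1' : f w.1 ≠ ∞ := ne_top_of_le_ne_top one_ne_top (hf1 _)
  have e2 := (ENNReal.add_right_inj (ENNReal.mul_ne_top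
    (ne_top_of_le_ne_top one_ne_top tsub_le_self) hfin)).1 e
  have e3 : B w = A w := (ENNReal.mul_right_inj hfw hf1').1 e2
  have e4 : dist w.2.1 w.1 ^ 2 + dist w.1 w.2.2 ^ 2
      = dist w.2.1 w.1 ^ 2 / t + dist w.1 w.2.2 ^ 2 / (1 - t) := by
    have := congrArg ENNReal.toReal e3
    rwa [ENNReal.toReal_ofReal (by positivity), ENNReal.toReal_ofReal (by positivity)] at this
  have a1 : dist w.2.1 w.1 ^ 2 / t = dist w.2.1 w.1 ^ 2 + dist w.2.1 w.1 ^ 2 * ((1 - t) / t) := by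
    field_simp; ring
  have a2 : dist w.1 w.2.2 ^ 2 / (1 - t)
      = dist w.1 w.2.2 ^ 2 + dist w.1 w.2.2 ^ 2 * (t / (1 - t)) := by
    field_simp; ring
  rw [a1, a2] at e4
  have b1 : 0 ≤ dist w.2.1 w.1 ^ 2 * ((1 - t) / t) := by positivity
  have b2 : 0 ≤ dist w.1 w.2.2 ^ 2 * (t / (1 - t)) := by positivity
  have c1 : dist w.2.1 w.1 ^ 2 * ((1 - t) / t) = 0 := by linarith
  have c2 : dist w.1 w.2.2 ^ 2 * (t / (1 - t)) = 0 := by linarith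
  have d1 : dist w.2.1 w.1 = 0 := by
    rcases mul_eq_zero.1 c1 with h | h
    · exact pow_eq_zero_iff (two_ne_zero) |>.1 h
    · exact absurd h (by positivity)
  have d2 : dist w.1 w.2.2 = 0 := by
    rcases mul_eq_zero.1 c2 with h | h
    · exact pow_eq_zero_iff (two_ne_zero) |>.1 h
    · exact absurd h (by positivity)
  rw [dist_eq_zero.1 d1, dist_eq_zero.1 d2]

lemma opt_exists {X : Type*} [MetricSpace X] [SecondCountableTopology X]
    [MeasurableSpace X] [BorelSpace X] {m : Measure X}
    {K N : ℝ} (hCD : CD K N m) {x₀ : X} {R : ℝ} (hR : ∀ᵐ x ∂m, dist x x₀ ≤ R)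
    {μ ν : Measure X} [IsProbabilityMeasure μ] [IsProbabilityMeasure ν]
    (hμ : μ ≪ m) (hν : ν ≪ m) :
    ∃ q, IsCoupling q μ ν ∧ ∫⁻ p, edist p.1 p.2 ^ 2 ∂q = Wsq μ ν := by
  obtain ⟨_, q, _, _, _, _, hq, hc, _⟩ :=
    hCD μ ν (memP2_of_bdd hR hμ) (memP2_of_bdd hR hν) hμ hν
  exact ⟨q, hq, hc⟩

lemma max_diag {X : Type*} [MetricSpace X] [SecondCountableTopology X]
    [MeasurableSpace X] [BorelSpace X]
    {μ ν : Measure X} [IsProbabilityMeasure μ] 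
    (hex : ∃ q, IsCoupling q μ ν ∧ ∫⁻ p, edist p.1 p.2 ^ 2 ∂q = Wsq μ ν)
    {δ : ℝ≥0∞} (hδ : δ ≠ 0) :
    ∃ q, (IsCoupling q μ ν ∧ ∫⁻ p, edist p.1 p.2 ^ 2 ∂q = Wsq μ ν) ∧
      ∀ p, IsCoupling p μ ν → ∫⁻ w, edist w.1 w.2 ^ 2 ∂p ≤ Wsq μ ν →
        p {w | w.1 = w.2} ≤ q {w | w.1 = w.2} + δ := by
  obtain ⟨q0, hq0⟩ := hex
  set S : Set ℝ≥0∞ := {c | ∃ q, (IsCoupling q μ ν ∧ ∫⁻ p, edist p.1 p.2 ^ 2 ∂q = Wsq μ ν) ∧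
    q {w | w.1 = w.2} = c} with hS
  have hle : ∀ p, IsCoupling p μ ν → ∫⁻ w, edist w.1 w.2 ^ 2 ∂p ≤ Wsq μ ν →
      p {w | w.1 = w.2} ≤ sSup S := by
    intro p hp hc
    exact le_sSup ⟨p, ⟨hp, le_antisymm hc (Wsq_le hp)⟩, rfl⟩
  have hfin : sSup S ≠ ∞ := by
    apply ne_top_of_le_ne_top one_ne_top
    apply sSup_le
    rintro c ⟨q, hq, rfl⟩
    have := hq.1.prob
    exact prob_le_one
  rcases eq_or_ne (sSup S) 0 with h0 | h0
  · refine ⟨q0, hq0, fun p hp hc => ?_⟩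
    exact (hle p hp hc).trans (by rw [h0]; exact zero_le)
  · have hlt : sSup S - δ < sSup S := ENNReal.sub_lt_self hfin h0 hδ
    obtain ⟨c, ⟨q, hq, rfl⟩, hc⟩ := exists_lt_of_lt_csSup (s := S) ⟨_, q0, hq0, rfl⟩ hlt
    refine ⟨q, hq, fun p hp hpc => (hle p hp hpc).trans ?_⟩
    exact tsub_le_iff_right.1 hc.le

lemma decomp {X : Type*} [MetricSpace X] [SecondCountableTopology X]
    [MeasurableSpace X] [BorelSpace X]
    {μ ν : Measure X} [IsProbabilityMeasure μ] (hne : μ ≠ ν)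
    (hex : ∃ q, IsCoupling q μ ν ∧ ∫⁻ p, edist p.1 p.2 ^ 2 ∂q = Wsq μ ν)
    {δ : ℝ≥0∞} (hδ : δ ≠ 0) :
    ∃ (η N₀ N₁ : Measure X) (M : ℝ≥0∞), IsFiniteMeasure η ∧ IsProbabilityMeasure N₀ ∧
      IsProbabilityMeasure N₁ ∧ M ≠ 0 ∧ M ≤ 1 ∧ μ = η + M • N₀ ∧ ν = η + M • N₁ ∧
      M * Wsq N₀ N₁ ≤ Wsq μ ν ∧
      ∀ p, IsCoupling p N₀ N₁ → M * ∫⁻ w, edist w.1 w.2 ^ 2 ∂p ≤ Wsq μ ν →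
        M * p {w | w.1 = w.2} ≤ δ := by
  obtain ⟨q, ⟨hq, hqc⟩, hmax⟩ := max_diag hex hδ
  have hqp := hq.prob
  set D : Set (X × X) := {w | w.1 = w.2} with hD
  have mD : MeasurableSet D := meas_D
  set M := q Dᶜ with hM
  have hae : (Prod.fst : X × X → X) =ᵐ[q.restrict D] Prod.snd := by
    filter_upwards [ae_restrict_mem mD] with w hw using hw
  set η := (q.restrict D).map Prod.fst with hη
  have hη2 : (q.restrict D).map Prod.snd = η := (Measure.map_congr hae).symm
  have hsum : q.restrict D + q.restrict Dᶜ = q := Measure.restrict_add_restrict_compl mD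
  have hμ : μ = η + (q.restrict Dᶜ).map Prod.fst := by
    rw [hη, ← Measure.map_add _ _ measurable_fst, hsum, hq.1]
  have hν : ν = η + (q.restrict Dᶜ).map Prod.snd := by
    rw [← hη2, ← Measure.map_add _ _ measurable_snd, hsum, hq.2]
  have hM0 : M ≠ 0 := by
    intro h
    apply hne
    have : q.restrict Dᶜ = 0 := Measure.restrict_eq_zero.2 h
    rw [hμ, hν, this]; simp
  have hM1 : M ≤ 1 := prob_le_one
  have hMt : M ≠ ∞ := ne_top_of_le_ne_top one_ne_top hM1
  have hηu : η univ = q D := by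
    rw [hη, Measure.map_apply measurable_fst MeasurableSet.univ]; simp
  have e0 : M • (M⁻¹ • (q.restrict Dᶜ).map Prod.fst) = (q.restrict Dᶜ).map Prod.fst := by
    rw [smul_smul, ENNReal.mul_inv_cancel hM0 hMt, one_smul]
  have e1 : M • (M⁻¹ • (q.restrict Dᶜ).map Prod.snd) = (q.restrict Dᶜ).map Prod.snd := by
    rw [smul_smul, ENNReal.mul_inv_cancel hM0 hMt, one_smul]
  refine ⟨η, M⁻¹ • (q.restrict Dᶜ).map Prod.fst, M⁻¹ • (q.restrict Dᶜ).map Prod.snd, M,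
    ⟨by rw [hηu]; exact measure_lt_top _ _⟩, ⟨?_⟩, ⟨?_⟩, hM0, hM1, by rw [e0]; exact hμ, by rw [e1]; exact hν, ?_, ?_⟩
  · rw [Measure.smul_apply, Measure.map_apply measurable_fst MeasurableSet.univ]
    simp only [preimage_univ, Measure.restrict_apply_univ, smul_eq_mul]
    exact ENNReal.inv_mul_cancel hM0 hMt
  · rw [Measure.smul_apply, Measure.map_apply measurable_snd MeasurableSet.univ]
    simp only [preimage_univ, Measure.restrict_apply_univ, smul_eq_mul]
    exact ENNReal.inv_mul_cancel hM0 hMt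
  · have hc : IsCoupling (M⁻¹ • q.restrict Dᶜ) (M⁻¹ • (q.restrict Dᶜ).map Prod.fst)
        (M⁻¹ • (q.restrict Dᶜ).map Prod.snd) := IsCoupling.smul ⟨rfl, rfl⟩ _
    calc _ ≤ M * ∫⁻ p, edist p.1 p.2 ^ 2 ∂(M⁻¹ • q.restrict Dᶜ) := by
          gcongr; exact Wsq_le hc
      _ = ∫⁻ p, edist p.1 p.2 ^ 2 ∂(q.restrict Dᶜ) := by
          rw [lintegral_smul_measure, smul_eq_mul, ← mul_assoc, ENNReal.mul_inv_cancel hM0 hMt,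
            one_mul]
      _ ≤ ∫⁻ p, edist p.1 p.2 ^ 2 ∂q := lintegral_mono' Measure.restrict_le_self le_rfl
      _ = _ := hqc
  · intro p hp hpc
    have hc : IsCoupling (diagM η + M • p) μ ν := by
      have := (isCoupling_diagM η).add (hp.smul M)
      rw [e0, e1] at this
      rwa [hμ, hν]
    have h1 := hmax _ hc (by
      rw [lintegral_add_measure, cost_diagM, zero_add, lintegral_smul_measure, smul_eq_mul]
      exact hpc)
    have h2 : (diagM η) D = q D := by
      rw [diagM, Measure.map_apply meas_diag mD, ← hηu]
      congr 1
      ext x; simp [hD]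
    rw [Measure.add_apply, h2, Measure.smul_apply, smul_eq_mul] at h1
    exact (ENNReal.add_le_add_iff_left (measure_ne_top q D)).1 h1

lemma LA_geom {X : Type*} [MetricSpace X] [CompleteSpace X] [SecondCountableTopology X]
    [MeasurableSpace X] [BorelSpace X] {m : Measure X} [IsProbabilityMeasure m]
    {K N : ℝ} (hCD : CD K N m) {x₀ : X} {R : ℝ} (hR : ∀ᵐ x ∂m, dist x x₀ ≤ R)
    {μ₀ μ₁ : Measure X} [IsProbabilityMeasure μ₀] [IsProbabilityMeasure μ₁]
    (h0 : μ₀ ≪ m) (h1 : μ₁ ≪ m) (hne : μ₀ ≠ μ₁) {t : ℝ} (ht0 : 0 < t) (ht1 : t < 1)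
    {δ : ℝ≥0∞} (hδ : δ ≠ 0) :
    ∃ (η N₀ N₁ σ : Measure X) (M : ℝ≥0∞) (q π : Measure (X × X)),
      IsFiniteMeasure η ∧ IsProbabilityMeasure N₀ ∧
      IsProbabilityMeasure N₁ ∧ IsProbabilityMeasure σ ∧ M ≠ 0 ∧ M ≤ 1 ∧ η ≪ m ∧ N₀ ≪ m ∧ N₁ ≪ m ∧
      σ ≪ m ∧ μ₀ = η + M • N₀ ∧ μ₁ = η + M • N₁ ∧
      IsCoupling q N₀ N₁ ∧ M * ∫⁻ w, edist w.1 w.2 ^ 2 ∂q = Wsq μ₀ μ₁ ∧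
      M * q {w | w.1 = w.2} ≤ δ ∧
      IsCoupling π N₀ σ ∧ M * ∫⁻ w, edist w.1 w.2 ^ 2 ∂π = ENNReal.ofReal (t ^ 2) * Wsq μ₀ μ₁ ∧
      ∫⁻ x, min (η.rnDeriv m x) ((M • σ).rnDeriv m x) ∂m ≤ δ ∧
      ∫⁻ p, tauCoef K N (1-t) (dist p.1 p.2) * (N₀.rnDeriv m p.1) ^ (-(1/N) : ℝ)
            + tauCoef K N t (dist p.1 p.2) * (N₁.rnDeriv m p.2) ^ (-(1/N) : ℝ) ∂q
        ≤ ∫⁻ x, (σ.rnDeriv m x) ^ (1 - 1/N : ℝ) ∂m := by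
  obtain ⟨η, N₀, N₁, M, iη, i0, i1, hM0, hM1, e0, e1, hW, hp⟩ :=
    decomp hne (opt_exists hCD hR h0 h1) hδ
  have hMt : M ≠ ∞ := ne_top_of_le_ne_top one_ne_top hM1
  have aη : η ≪ m := by
    refine Measure.AbsolutelyContinuous.trans ?_ h0
    rw [e0]; exact Measure.absolutelyContinuous_of_le (Measure.le_add_right le_rfl)
  have a0 : N₀ ≪ m := by
    refine Measure.AbsolutelyContinuous.trans (Measure.absolutelyContinuous_smul hM0) ?_
    refine Measure.AbsolutelyContinuous.trans ?_ h0
    rw [e0]; exact Measure.absolutelyContinuous_of_le (Measure.le_add_left le_rfl)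
  have a1 : N₁ ≪ m := by
    refine Measure.AbsolutelyContinuous.trans (Measure.absolutelyContinuous_smul hM0) ?_
    refine Measure.AbsolutelyContinuous.trans ?_ h1
    rw [e1]; exact Measure.absolutelyContinuous_of_le (Measure.le_add_left le_rfl)
  obtain ⟨μ, q, hμ0, hμ1, hg, hac, hq, hqc, hcd⟩ :=
    hCD N₀ N₁ (memP2_of_bdd hR a0) (memP2_of_bdd hR a1) a0 a1
  have htI : t ∈ Icc (0:ℝ) 1 := ⟨ht0.le, ht1.le⟩
  have W0 : Wsq N₀ (μ t) = ENNReal.ofReal (t ^ 2) * Wsq N₀ N₁ := by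
    have := geod_Wsq hg (s := 0) (t := t) ⟨le_rfl, zero_le_one⟩ htI
    rwa [hμ0, hμ1, zero_sub, abs_neg, sq_abs] at this
  have W1 : Wsq (μ t) N₁ = ENNReal.ofReal ((1 - t) ^ 2) * Wsq N₀ N₁ := by
    have := geod_Wsq hg (s := t) (t := 1) htI ⟨zero_le_one, le_rfl⟩
    rwa [hμ0, hμ1, abs_sub_comm, sq_abs] at this
  have hfin : Wsq N₀ N₁ ≠ ∞ := Wsq_ne_top hR a0 a1
  set σ := μ t with hσ
  have aσ : σ ≪ m := hac t htI
  have iσ : IsProbabilityMeasure σ := by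
    obtain ⟨p, hp⟩ := exists_coupling (μ := N₀) (ν := σ)
      (by rw [W0]; exact ENNReal.mul_ne_top ENNReal.ofReal_ne_top hfin)
    exact hp.prob_right
  obtain ⟨π₁, hπ1, hc1⟩ := opt_exists hCD hR a0 aσ
  obtain ⟨π₂, hπ2, hc2⟩ := opt_exists hCD hR aσ a1
  have hWeq : Wsq μ₀ μ₁ = M * Wsq N₀ N₁ := by
    refine le_antisymm ?_ hW
    have hc : IsCoupling (diagM η + M • q) μ₀ μ₁ := by
      rw [e0, e1]; exact (isCoupling_diagM η).add (hq.smul M)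
    refine (Wsq_le hc).trans ?_
    rw [lintegral_add_measure, cost_diagM, zero_add, lintegral_smul_measure, smul_eq_mul, hqc]
  obtain ⟨P, hP1, hP2⟩ := glue hπ1 hπ2
  have mx : Measurable (fun w : X × X × X => w.1) := measurable_fst
  have my : Measurable (fun w : X × X × X => w.2.1) := measurable_snd.fst
  have mz : Measurable (fun w : X × X × X => w.2.2) := measurable_snd.snd
  have Py : P.map (fun w => w.2.1) = N₀ := by
    rw [← hπ1.1, ← hP1, Measure.map_map measurable_fst (my.prodMk mx)]; rfl
  have Px : P.map (fun w => w.1) = σ := by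
    rw [← hπ1.2, ← hP1, Measure.map_map measurable_snd (my.prodMk mx)]; rfl
  have Pz : P.map (fun w => w.2.2) = N₁ := by
    rw [← hπ2.2, ← hP2, Measure.map_map measurable_snd (mx.prodMk mz)]; rfl
  have iP : IsProbabilityMeasure P := by
    constructor
    have := congrArg (fun ν : Measure X => ν univ) Px
    simp only [measure_univ] at this
    rwa [Measure.map_apply mx MeasurableSet.univ, preimage_univ] at this
  have cy : ∫⁻ w, edist w.2.1 w.1 ^ 2 ∂P = ENNReal.ofReal (t ^ 2) * Wsq N₀ N₁ := by
    rw [← W0, ← hc1, ← hP1, lintegral_map meas_cost (my.prodMk mx)]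
  have cz : ∫⁻ w, edist w.1 w.2.2 ^ 2 ∂P = ENNReal.ofReal ((1 - t) ^ 2) * Wsq N₀ N₁ := by
    rw [← W1, ← hc2, ← hP2, lintegral_map meas_cost (mx.prodMk mz)]
  have iMP : IsFiniteMeasure (M • P) := by
    constructor
    rw [Measure.smul_apply, measure_univ, smul_eq_mul, mul_one]
    exact hMt.lt_top
  have iMσ : IsFiniteMeasure (M • σ) := by
    constructor
    rw [Measure.smul_apply, measure_univ, smul_eq_mul, mul_one]
    exact hMt.lt_top
  have aMσ : M • σ ≪ m := Measure.AbsolutelyContinuous.smul_left aσ M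
  set h := η.rnDeriv m with hh
  set r := (M • σ).rnDeriv m with hr
  have mh : Measurable h := Measure.measurable_rnDeriv _ _
  have mr : Measurable r := Measure.measurable_rnDeriv _ _
  set f : X → ℝ≥0∞ := fun x => min 1 (h x / r x) with hf
  have mf : Measurable f := measurable_const.min (mh.div mr)
  have hrm : m.withDensity r = M • σ := Measure.withDensity_rnDeriv_eq _ _ aMσ
  have hhm : m.withDensity h = η := Measure.withDensity_rnDeriv_eq _ _ aη
  have hsw := swap_lemma (P := M • P) (η := η) (f := f) mf (fun x => min_le_left _ _)
    (by
      rw [Measure.map_smul, Px, ← hrm, ← withDensity_mul _ mr mf]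
      conv_rhs => rw [← hhm]
      apply withDensity_mono
      refine ae_of_all _ fun x => ?_
      simp only [Pi.mul_apply]
      exact (mul_le_mul_right (min_le_right _ _) _).trans ENNReal.mul_div_le)
    (Q := Wsq μ₀ μ₁) (by rw [hWeq]; exact ENNReal.mul_ne_top hMt hfin)
    (by rw [Measure.map_smul, Measure.map_smul, Py, Pz, ← e0, ← e1]) ht0 ht1
    (by rw [lintegral_smul_measure, cy, hWeq, smul_eq_mul, mul_left_comm])
    (by rw [lintegral_smul_measure, cz, hWeq, smul_eq_mul, mul_left_comm])
  have hpp := hp (P.map (fun w => (w.2.1, w.2.2)))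
    ⟨by rw [Measure.map_map measurable_fst (my.prodMk mz)]; exact Py,
     by rw [Measure.map_map measurable_snd (my.prodMk mz)]; exact Pz⟩
    (by
      rw [hWeq, lintegral_map meas_cost (my.prodMk mz)]
      gcongr
      refine le_trans (lintegral_mono fun w => ?_) (lintegral_A ht0 ht1 cy.le cz.le)
      exact edist_sq_split _ _ _ ht0 ht1)
  refine ⟨η, N₀, N₁, σ, M, q, π₁, iη, i0, i1, iσ, hM0, hM1, aη, a0, a1, aσ, e0, e1, hq,
    by rw [hqc, hWeq], hp q hq (by rw [hqc, hWeq]), hπ1, by rw [hc1, W0, hWeq, mul_left_comm], ?_, hcd t htI⟩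
  refine le_trans ?_ hpp
  have hrt : ∀ᵐ x ∂m, r x < ∞ := Measure.rnDeriv_lt_top _ _
  calc ∫⁻ x, min (h x) (r x) ∂m = ∫⁻ x, (r * f) x ∂m := by
        apply lintegral_congr_ae
        filter_upwards [hrt] with x hx
        simp only [Pi.mul_apply, hf]
        rcases eq_or_ne (r x) 0 with h0 | h0
        · simp [h0]
        · rw [mul_min, mul_one, ENNReal.mul_div_cancel h0 hx.ne, min_comm]
    _ = ∫⁻ x, f x ∂(M • σ) := by
        rw [← hrm, lintegral_withDensity_eq_lintegral_mul _ mr mf]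
    _ = ∫⁻ w, f w.1 ∂(M • P) := by
        rw [← Px, ← Measure.map_smul, lintegral_map mf mx]
    _ ≤ ∫⁻ w, ({w | w.2.1 = w.2.2} : Set (X × X × X)).indicator 1 w ∂(M • P) := by
        apply lintegral_mono_ae
        filter_upwards [hsw] with w hw
        by_cases h : f w.1 = 0
        · rw [h]; exact zero_le
        · rw [indicator_of_mem (by exact hw h)]
          exact min_le_left _ _
    _ = M * (P.map (fun w => (w.2.1, w.2.2))) {w | w.1 = w.2} := by
        rw [lintegral_indicator_one (measurableSet_eq_fun my mz), Measure.smul_apply, smul_eq_mul,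
          Measure.map_apply (my.prodMk mz) meas_D]
        rfl

/-- integrand of the lower bound -/
def lowInt {X : Type*} [MetricSpace X] (K N t : ℝ) (φ₀ φ₁ : X → ℝ≥0∞) (p : X × X) : ℝ≥0∞ :=
  ENNReal.ofReal (lowCoef K N (1 - t) (dist p.1 p.2)) * φ₀ p.1
    + ENNReal.ofReal (lowCoef K N t (dist p.1 p.2)) * φ₁ p.2

lemma lowCoef_zero (K N s : ℝ) : lowCoef K N s 0 = s := by
  unfold lowCoef; ring

lemma meas_lowInt {X : Type*} [MetricSpace X] [SecondCountableTopology X]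
    [MeasurableSpace X] [BorelSpace X] (K N t : ℝ) {φ₀ φ₁ : X → ℝ≥0∞} (h0 : Measurable φ₀)
    (h1 : Measurable φ₁) : Measurable (lowInt K N t φ₀ φ₁) := by
  have md : Measurable (fun p : X × X => dist p.1 p.2) := measurable_fst.dist measurable_snd
  have ml : ∀ s, Measurable (fun p : X × X => ENNReal.ofReal (lowCoef K N s (dist p.1 p.2))) := by
    intro s
    apply Measurable.ennreal_ofReal
    unfold lowCoef
    fun_prop
  exact ((ml _).mul (h0.comp measurable_fst)).add ((ml _).mul (h1.comp measurable_snd))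

lemma mul_rpow_neg_le {h ρ : ℝ≥0∞} {b : ℝ} (hb : 0 < b) (hle : h ≤ ρ) (hh : h ≠ ∞) :
    h * ρ ^ (-b) ≤ h ^ (1 - b) := by
  rcases eq_or_ne h 0 with h0 | h0
  · simp [h0]
  · calc h * ρ ^ (-b) ≤ h * h ^ (-b) := by
          refine mul_le_mul_right ?_ _
          rw [ENNReal.rpow_neg, ENNReal.rpow_neg]
          exact ENNReal.inv_le_inv.2 (ENNReal.rpow_le_rpow hle hb.le)
      _ = h ^ (1 - b) := by
          rw [sub_eq_add_neg, ENNReal.rpow_add _ _ h0 hh, ENNReal.rpow_one]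

lemma mul_rpow_neg_le' {M x ρ : ℝ≥0∞} {b : ℝ} (hb : 0 < b) (hle : M * x ≤ ρ) (hM : M ≠ ∞)
    (hM0 : M ≠ 0) (hx0 : x ≠ 0) :
    M * ρ ^ (-b) ≤ M ^ (1 - b) * x ^ (-b) := by
  calc M * ρ ^ (-b) ≤ M * (M * x) ^ (-b) := by
          refine mul_le_mul_right ?_ _
          rw [ENNReal.rpow_neg, ENNReal.rpow_neg]
          exact ENNReal.inv_le_inv.2 (ENNReal.rpow_le_rpow hle hb.le)
      _ = M ^ (1 - b) * x ^ (-b) := by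
          rw [ENNReal.mul_rpow_of_ne_zero hM0 hx0, ← mul_assoc, sub_eq_add_neg,
            ENNReal.rpow_add _ _ hM0 hM, ENNReal.rpow_one]

lemma rpow_min_add {h r : ℝ≥0∞} {a : ℝ} (ha : 0 < a) :
    h ^ a + r ^ a ≤ (h + r) ^ a + (min h r) ^ a := by
  rcases le_total h r with hl | hl
  · rw [min_eq_left hl, add_comm]
    gcongr
    exact le_add_left le_rfl
  · rw [min_eq_right hl]
    gcongr
    exact le_add_right le_rfl

lemma lemmaA {X : Type*} [MetricSpace X] [CompleteSpace X] [SecondCountableTopology X]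
    [MeasurableSpace X] [BorelSpace X] {m : Measure X} [IsProbabilityMeasure m]
    {K N : ℝ} (hK : 0 < K) (hN : 1 < N)
    (hCD : CD K N m) {x₀ : X} {R : ℝ} (hR : ∀ᵐ x ∂m, dist x x₀ ≤ R)
    {μ₀ μ₁ : Measure X} [IsProbabilityMeasure μ₀] [IsProbabilityMeasure μ₁]
    (h0 : μ₀ ≪ m) (h1 : μ₁ ≪ m) (hne : μ₀ ≠ μ₁)
    {φ₀ φ₁ : X → ℝ≥0∞} (mφ0 : Measurable φ₀) (mφ1 : Measurable φ₁)
    (eφ0 : ∀ᵐ x ∂m, φ₀ x = (μ₀.rnDeriv m x) ^ (-(1/N) : ℝ))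
    (eφ1 : ∀ᵐ x ∂m, φ₁ x = (μ₁.rnDeriv m x) ^ (-(1/N) : ℝ))
    (bφ0 : ∀ x, φ₀ x ≤ 2) (bφ1 : ∀ x, φ₁ x ≤ 2)
    {t : ℝ} (ht0 : 0 < t) (ht1 : t < 1)
    {δ : ℝ≥0∞} (hδ : δ ≠ 0) :
    ∃ (μt : Measure X) (q π : Measure (X × X)), IsProbabilityMeasure μt ∧ μt ≪ m ∧
      IsCoupling q μ₀ μ₁ ∧ ∫⁻ w, edist w.1 w.2 ^ 2 ∂q = Wsq μ₀ μ₁ ∧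
      IsCoupling π μ₀ μt ∧ ∫⁻ w, edist w.1 w.2 ^ 2 ∂π = ENNReal.ofReal (t ^ 2) * Wsq μ₀ μ₁ ∧
      ∫⁻ p, lowInt K N t φ₀ φ₁ p ∂q
        ≤ ∫⁻ x, (μt.rnDeriv m x) ^ (1 - 1/N : ℝ) ∂m + (δ ^ (1 - 1/N : ℝ) + 2 * δ) := by
  obtain ⟨η, N₀, N₁, σ, M, q, π, iη, i0, i1, iσ, hM0, hM1, aη, a0, a1, aσ, e0, e1, hq, hqc, hqD,
    hπ, hπc, hmin, hcd⟩ := LA_geom hCD hR h0 h1 hne ht0 ht1 hδ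
  have hMt : M ≠ ∞ := ne_top_of_le_ne_top one_ne_top hM1
  have hN0 : 0 < N := by linarith
  have hb : 0 < 1 / N := by positivity
  have hb1 : 1 / N < 1 := by rw [div_lt_one hN0]; exact hN
  have ha : 0 < 1 - 1 / N := by linarith
  have iM : ∀ ν : Measure X, IsProbabilityMeasure ν → IsFiniteMeasure (M • ν) := by
    intro ν hν
    constructor
    rw [Measure.smul_apply, measure_univ, smul_eq_mul, mul_one]
    exact hMt.lt_top
  have iMσ := iM σ iσ
  have iM0 := iM N₀ i0
  have iM1 := iM N₁ i1
  have hπ' : IsCoupling (diagM η + M • π) μ₀ (η + M • σ) := by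
    have := (isCoupling_diagM η).add (hπ.smul M)
    rwa [← e0] at this
  have iμt : IsProbabilityMeasure (η + M • σ) := hπ'.prob_right
  refine ⟨η + M • σ, diagM η + M • q, diagM η + M • π, iμt, ?_, ?_, ?_, hπ', ?_, ?_⟩
  · rw [Measure.AbsolutelyContinuous.add_left_iff]
    exact ⟨aη, Measure.AbsolutelyContinuous.smul_left aσ M⟩
  · have := (isCoupling_diagM η).add (hq.smul M)
    rwa [← e0, ← e1] at this
  · rw [lintegral_add_measure, cost_diagM, zero_add, lintegral_smul_measure, smul_eq_mul, hqc]
  · rw [lintegral_add_measure, cost_diagM, zero_add, lintegral_smul_measure, smul_eq_mul, hπc]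
  set h := η.rnDeriv m with hh
  set r := (M • σ).rnDeriv m with hr
  have mh : Measurable h := Measure.measurable_rnDeriv _ _
  have mr : Measurable r := Measure.measurable_rnDeriv _ _
  have hhm : m.withDensity h = η := Measure.withDensity_rnDeriv_eq _ _ aη
  have d0 : μ₀.rnDeriv m =ᵐ[m] h + (M • N₀).rnDeriv m := by
    rw [e0]; exact Measure.rnDeriv_add' _ _ _
  have d1 : μ₁.rnDeriv m =ᵐ[m] h + (M • N₁).rnDeriv m := by
    rw [e1]; exact Measure.rnDeriv_add' _ _ _
  have dt : (η + M • σ).rnDeriv m =ᵐ[m] h + r := Measure.rnDeriv_add' _ _ _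
  have s0 : (M • N₀).rnDeriv m =ᵐ[m] M • N₀.rnDeriv m :=
    Measure.rnDeriv_smul_left_of_ne_top' _ _ hMt
  have s1 : (M • N₁).rnDeriv m =ᵐ[m] M • N₁.rnDeriv m :=
    Measure.rnDeriv_smul_left_of_ne_top' _ _ hMt
  have sσ : r =ᵐ[m] M • σ.rnDeriv m :=
    Measure.rnDeriv_smul_left_of_ne_top' _ _ hMt
  have mlow := meas_lowInt K N t mφ0 mφ1
  have hof : ENNReal.ofReal (1 - t) + ENNReal.ofReal t = 1 := by
    rw [← ENNReal.ofReal_add (by linarith) ht0.le]; simp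
  -- the diagonal part
  have part1 : ∫⁻ p, lowInt K N t φ₀ φ₁ p ∂(diagM η) ≤ ∫⁻ x, h x ^ (1 - 1 / N : ℝ) ∂m := by
    rw [lintegral_diagM _ mlow]
    conv_lhs => rw [← hhm]
    have mm : Measurable (fun x => lowInt K N t φ₀ φ₁ (x, x)) := mlow.comp meas_diag
    rw [lintegral_withDensity_eq_lintegral_mul _ mh mm]
    apply lintegral_mono_ae
    filter_upwards [d0, d1, eφ0, eφ1, Measure.rnDeriv_lt_top η m] with x x0 x1 y0 y1 hfin
    simp only [Pi.mul_apply, lowInt, dist_self, lowCoef_zero]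
    have g0 : h x * φ₀ x ≤ h x ^ (1 - 1 / N : ℝ) := by
      rw [y0]; apply mul_rpow_neg_le hb _ hfin.ne
      rw [x0]; exact le_add_right le_rfl
    have g1 : h x * φ₁ x ≤ h x ^ (1 - 1 / N : ℝ) := by
      rw [y1]; apply mul_rpow_neg_le hb _ hfin.ne
      rw [x1]; exact le_add_right le_rfl
    calc h x * (ENNReal.ofReal (1 - t) * φ₀ x + ENNReal.ofReal t * φ₁ x)
        = ENNReal.ofReal (1 - t) * (h x * φ₀ x) + ENNReal.ofReal t * (h x * φ₁ x) := by ring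
      _ ≤ ENNReal.ofReal (1 - t) * h x ^ (1 - 1 / N : ℝ)
          + ENNReal.ofReal t * h x ^ (1 - 1 / N : ℝ) := by gcongr
      _ = h x ^ (1 - 1 / N : ℝ) := by rw [← add_mul, hof, one_mul]
  have part2 : M * ∫⁻ p, lowInt K N t φ₀ φ₁ p ∂q ≤ ∫⁻ x, r x ^ (1 - 1 / N : ℝ) ∂m + 2 * δ := by
    set D : Set (X × X) := {w | w.1 = w.2} with hD
    have mD : MeasurableSet D := meas_D
    have hMa : M ^ (1 - 1 / N : ℝ) ≠ ∞ := ENNReal.rpow_ne_top_of_nonneg ha.le hMt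
    have hpt : ∀ᵐ p ∂q, M * lowInt K N t φ₀ φ₁ p ≤
        M ^ (1 - 1 / N : ℝ) *
          (tauCoef K N (1-t) (dist p.1 p.2) * (N₀.rnDeriv m p.1) ^ (-(1/N) : ℝ)
            + tauCoef K N t (dist p.1 p.2) * (N₁.rnDeriv m p.2) ^ (-(1/N) : ℝ))
        + 2 * M * D.indicator 1 p := by
      filter_upwards [ac_of_coupling hq (a0.ae_le d0), ac_of_coupling' hq (a1.ae_le d1),
        ac_of_coupling hq (a0.ae_le s0), ac_of_coupling' hq (a1.ae_le s1),
        ac_of_coupling hq (a0.ae_le eφ0), ac_of_coupling' hq (a1.ae_le eφ1),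
        ac_of_coupling hq (Measure.rnDeriv_pos a0), ac_of_coupling' hq (Measure.rnDeriv_pos a1)]
        with p x0 x1 z0 z1 y0 y1 w0 w1
      by_cases hp : p ∈ D
      · have hd : dist p.1 p.2 = 0 := by rw [dist_eq_zero]; exact hp
        rw [indicator_of_mem hp]
        refine le_add_left ?_
        simp only [lowInt, hd, lowCoef_zero, Pi.one_apply, mul_one]
        rw [mul_comm 2 M]
        gcongr
        calc _ ≤ ENNReal.ofReal (1 - t) * 2 + ENNReal.ofReal t * 2 := by
              gcongr
              · exact bφ0 _
              · exact bφ1 _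
          _ = 2 := by rw [← add_mul, hof, one_mul]
      · have hd : 0 < dist p.1 p.2 := by rw [dist_pos]; exact hp
        refine le_add_right ?_
        have g0 : M * φ₀ p.1 ≤ M ^ (1 - 1 / N : ℝ) * (N₀.rnDeriv m p.1) ^ (-(1/N) : ℝ) := by
          rw [y0]; apply mul_rpow_neg_le' hb _ hMt hM0 w0.ne'
          rw [x0, Pi.add_apply, z0]; exact le_add_left le_rfl
        have g1 : M * φ₁ p.2 ≤ M ^ (1 - 1 / N : ℝ) * (N₁.rnDeriv m p.2) ^ (-(1/N) : ℝ) := by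
          rw [y1]; apply mul_rpow_neg_le' hb _ hMt hM0 w1.ne'
          rw [x1, Pi.add_apply, z1]; exact le_add_left le_rfl
        have l0 := tau_lower hK hN (s := 1 - t) (by linarith) (by linarith) hd
        have l1 := tau_lower hK hN (s := t) (by linarith) (by linarith) hd
        unfold lowInt
        calc _ = ENNReal.ofReal (lowCoef K N (1 - t) (dist p.1 p.2)) * (M * φ₀ p.1)
              + ENNReal.ofReal (lowCoef K N t (dist p.1 p.2)) * (M * φ₁ p.2) := by ring
          _ ≤ tauCoef K N (1-t) (dist p.1 p.2) *
                (M ^ (1 - 1 / N : ℝ) * (N₀.rnDeriv m p.1) ^ (-(1/N) : ℝ))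
              + tauCoef K N t (dist p.1 p.2) *
                (M ^ (1 - 1 / N : ℝ) * (N₁.rnDeriv m p.2) ^ (-(1/N) : ℝ)) := by gcongr
          _ = _ := by ring
    have mI : Measurable (fun p : X × X => 2 * M * D.indicator (1 : X × X → ℝ≥0∞) p) :=
      (measurable_one.indicator mD).const_mul _
    calc M * ∫⁻ p, lowInt K N t φ₀ φ₁ p ∂q = ∫⁻ p, M * lowInt K N t φ₀ φ₁ p ∂q := by
          rw [lintegral_const_mul _ mlow]
      _ ≤ _ := lintegral_mono_ae hpt
      _ = M ^ (1 - 1 / N : ℝ) * (∫⁻ p,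
          (tauCoef K N (1-t) (dist p.1 p.2) * (N₀.rnDeriv m p.1) ^ (-(1/N) : ℝ)
            + tauCoef K N t (dist p.1 p.2) * (N₁.rnDeriv m p.2) ^ (-(1/N) : ℝ)) ∂q)
            + 2 * (M * q D) := by
          rw [lintegral_add_right _ mI, lintegral_const_mul' _ _ hMa,
            lintegral_const_mul _ (measurable_one.indicator mD), lintegral_indicator_one mD,
            mul_assoc 2 M]
      _ ≤ M ^ (1 - 1 / N : ℝ) * (∫⁻ x, (σ.rnDeriv m x) ^ (1 - 1/N : ℝ) ∂m) + 2 * δ := by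
          gcongr
      _ = _ := by
          congr 1
          rw [← lintegral_const_mul' _ _ hMa]
          apply lintegral_congr_ae
          filter_upwards [sσ] with x hx
          rw [hx, Pi.smul_apply, smul_eq_mul, ENNReal.mul_rpow_of_nonneg _ _ ha.le]
  have part3 : ∫⁻ x, h x ^ (1 - 1 / N : ℝ) ∂m + ∫⁻ x, r x ^ (1 - 1 / N : ℝ) ∂m
      ≤ ∫⁻ x, ((η + M • σ).rnDeriv m x) ^ (1 - 1/N : ℝ) ∂m + δ ^ (1 - 1 / N : ℝ) := by
    rw [← lintegral_add_left (mh.pow_const _)]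
    calc _ ≤ ∫⁻ x, (((η + M • σ).rnDeriv m x) ^ (1 - 1/N : ℝ)
          + (min (h x) (r x)) ^ (1 - 1/N : ℝ)) ∂m := by
          apply lintegral_mono_ae
          filter_upwards [dt] with x hx
          rw [hx]; exact rpow_min_add ha
      _ = ∫⁻ x, ((η + M • σ).rnDeriv m x) ^ (1 - 1/N : ℝ) ∂m
          + ∫⁻ x, (min (h x) (r x)) ^ (1 - 1/N : ℝ) ∂m :=
          lintegral_add_left ((Measure.measurable_rnDeriv _ _).pow_const _) _
      _ ≤ _ := by
          gcongr
          refine (jensen_rpow (mh.min mr).aemeasurable ha (by linarith)).trans ?_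
          exact ENNReal.rpow_le_rpow hmin ha.le
  rw [lintegral_add_measure, lintegral_smul_measure, smul_eq_mul]
  calc _ ≤ ∫⁻ x, h x ^ (1 - 1 / N : ℝ) ∂m + (∫⁻ x, r x ^ (1 - 1 / N : ℝ) ∂m + 2 * δ) :=
        add_le_add part1 part2
    _ ≤ _ := by
      rw [← add_assoc, ← add_assoc]
      exact add_le_add part3 le_rfl

lemma young_dens {N ρ s : ℝ} (hN : 1 < N) (hρ : 0 < ρ) (hs : 0 ≤ s) :
    s ^ (1 - 1 / N) ≤ (1 / N) * ρ ^ (1 - 1 / N) + (1 - 1 / N) * (ρ ^ (-(1 / N)) * s) := by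
  have hN0 : 0 < N := by linarith
  have hb1 : 1 / N < 1 := by rw [div_lt_one hN0]; exact hN
  have hb : 0 < 1 / N := by positivity
  have h := Real.geom_mean_le_arith_mean2_weighted (w₁ := 1 / N) (w₂ := 1 - 1 / N)
    (p₁ := ρ ^ (1 - 1 / N)) (p₂ := ρ ^ (-(1 / N)) * s) (by positivity) (by linarith)
    (by positivity) (by positivity) (by ring)
  refine le_trans (le_of_eq ?_) h
  rw [Real.mul_rpow (by positivity) hs, ← mul_assoc, ← Real.rpow_mul hρ.le, ← Real.rpow_mul hρ.le,
    ← Real.rpow_add hρ]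
  have : (1 - 1 / N) * (1 / N) + -(1 / N) * (1 - 1 / N) = 0 := by ring
  rw [this, Real.rpow_zero, one_mul]

lemma exists_delta {a e : ℝ} (ha : 0 < a) (he : 0 < e) :
    ∃ δ : ℝ≥0∞, δ ≠ 0 ∧ δ ^ a + 2 * δ ≤ ENNReal.ofReal e := by
  have hd : 0 < min ((e / 2) ^ (1 / a)) (e / 4) := by positivity
  refine ⟨ENNReal.ofReal (min ((e / 2) ^ (1 / a)) (e / 4)), by simpa using hd, ?_⟩
  have h1 : (min ((e / 2) ^ (1 / a)) (e / 4)) ^ a ≤ e / 2 := by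
    calc _ ≤ ((e / 2) ^ (1 / a)) ^ a := Real.rpow_le_rpow hd.le (min_le_left _ _) ha.le
      _ = e / 2 := by
        rw [← Real.rpow_mul (by positivity), one_div_mul_cancel ha.ne', Real.rpow_one]
  have h2 : min ((e / 2) ^ (1 / a)) (e / 4) ≤ e / 4 := min_le_right _ _
  generalize min ((e / 2) ^ (1 / a)) (e / 4) = d at *
  rw [ENNReal.ofReal_rpow_of_pos hd]
  have : (2 : ℝ≥0∞) = ENNReal.ofReal 2 := by simp
  rw [this, ← ENNReal.ofReal_mul (by norm_num), ← ENNReal.ofReal_add (by positivity) (by positivity)]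
  apply ENNReal.ofReal_le_ofReal
  linarith

lemma lemmaB1 {X : Type*} [MetricSpace X] [CompleteSpace X] [SecondCountableTopology X]
    [MeasurableSpace X] [BorelSpace X] {m : Measure X} [IsProbabilityMeasure m]
    {K N : ℝ} (hK : 0 < K) (hN : 1 < N)
    (hCD : CD K N m) {x₀ : X} {R : ℝ} (hR : ∀ᵐ x ∂m, dist x x₀ ≤ R)
    {ρ : X → ℝ} (mρ : Measurable ρ) (hρ1 : ∀ x, 1 / 2 ≤ ρ x) (hρ2 : ∀ x, ρ x ≤ 3 / 2)
    (hρm : ∫ x, ρ x ∂m = 1)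
    (hne : m.withDensity (fun x => ENNReal.ofReal (ρ x)) ≠ m)
    {f0 : ℝ} (hf0 : 0 ≤ f0) (hφm : ∀ x, f0 ≤ ρ x ^ (-(1 / N)))
    {G : X → ℝ} (mG : Measurable G) {Gb B : ℝ} (hG0 : ∀ x, 0 ≤ G x) (hGb : ∀ x, G x ≤ Gb)
    (hφ : ∀ x y, ρ y ^ (-(1 / N)) ≤ ρ x ^ (-(1 / N)) + G x * dist x y + B * dist x y ^ 2)
    {t β e : ℝ} (ht0 : 0 < t) (ht1 : t < 1) (hβ : 0 < β) (he : 0 < e) :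
    t * (1 - ∫ x, ρ x ^ (1 - 1 / N) ∂m) + K / (6 * N) * (t * ((1 - t) * (2 - t) * f0 + (1 - t ^ 2)))
        * (Wsq (m.withDensity (fun x => ENNReal.ofReal (ρ x))) m).toReal
      ≤ (1 - 1 / N) * (t * (∫ x, G x ^ 2 * ρ x ∂m) / (2 * β) + (β * t / 2 + B * t ^ 2)
        * (Wsq (m.withDensity (fun x => ENNReal.ofReal (ρ x))) m).toReal) + e := by
  have hN0 : 0 < N := by linarith
  have hb : 0 < 1 / N := by positivity
  have hb1 : 1 / N < 1 := by rw [div_lt_one hN0]; exact hN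
  have ha : 0 < 1 - 1 / N := by linarith
  have hρ0 : ∀ x, 0 < ρ x := fun x => lt_of_lt_of_le (by norm_num) (hρ1 x)
  set φ : X → ℝ := fun x => ρ x ^ (-(1 / N)) with hφdef
  have mφ : Measurable φ := mρ.pow_const _
  have φ0 : ∀ x, 0 ≤ φ x := fun x => Real.rpow_nonneg (hρ0 x).le _
  have φ2 : ∀ x, φ x ≤ 2 := by
    intro x
    calc φ x ≤ (1 / 2 : ℝ) ^ (-(1 / N)) :=
          Real.rpow_le_rpow_of_nonpos (by norm_num) (hρ1 x) (by linarith)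
      _ = 2 ^ (1 / N) := by
          rw [one_div (2:ℝ), Real.inv_rpow (by norm_num), Real.rpow_neg (by norm_num), inv_inv]
      _ ≤ 2 ^ (1 : ℝ) := Real.rpow_le_rpow_of_exponent_le (by norm_num) hb1.le
      _ = 2 := Real.rpow_one _
  set μ₀ := m.withDensity (fun x => ENNReal.ofReal (ρ x)) with hμ₀
  have mρe : Measurable (fun x => ENNReal.ofReal (ρ x)) := mρ.ennreal_ofReal
  have iρ : Integrable ρ m := Integrable.of_bound mρ.aestronglyMeasurable (3 / 2)
    (ae_of_all _ fun x => by rw [Real.norm_eq_abs, abs_of_pos (hρ0 x)]; exact hρ2 x)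
  have iμ₀ : IsProbabilityMeasure μ₀ := by
    constructor
    rw [hμ₀, withDensity_apply _ MeasurableSet.univ, Measure.restrict_univ,
      ← ofReal_integral_eq_lintegral_ofReal iρ (ae_of_all _ fun x => (hρ0 x).le), hρm]
    simp
  have a0 : μ₀ ≪ m := withDensity_absolutelyContinuous _ _
  have int0 : ∀ g : X → ℝ, ∫ x, g x ∂μ₀ = ∫ x, ρ x * g x ∂m := by
    intro g
    rw [hμ₀, integral_withDensity_eq_integral_toReal_smul mρe (by simp)]
    simp only [smul_eq_mul]
    congr 1; funext x
    rw [ENNReal.toReal_ofReal (hρ0 x).le]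
  obtain ⟨δ, hδ0, hδ⟩ := exists_delta ha he
  obtain ⟨μt, q, π, iμt, at', hq, hqc, hπ, hπc, hcd⟩ :=
    lemmaA hK hN hCD hR a0 Measure.AbsolutelyContinuous.rfl hne
      (φ₀ := fun x => ENNReal.ofReal (φ x)) (φ₁ := fun _ => 1)
      mφ.ennreal_ofReal measurable_const
      (by
        filter_upwards [Measure.rnDeriv_withDensity m mρe] with x hx
        rw [hx, ENNReal.ofReal_rpow_of_pos (hρ0 x)])
      (by
        filter_upwards [Measure.rnDeriv_self m] with x hx
        rw [hx]; simp)
      (fun x => by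
        rw [show (2:ℝ≥0∞) = ENNReal.ofReal 2 by simp]
        exact ENNReal.ofReal_le_ofReal (φ2 x))
      (fun x => by norm_num) ht0 ht1 hδ0
  have pq := hq.prob
  have pπ := hπ.prob
  set W := (Wsq μ₀ m).toReal with hW
  have hWf : Wsq μ₀ m ≠ ∞ := Wsq_ne_top hR a0 Measure.AbsolutelyContinuous.rfl
  have mdist : Measurable (fun p : X × X => dist p.1 p.2 ^ 2) :=
    (measurable_fst.dist measurable_snd).pow_const 2
  have id2 : ∀ (s : Measure (X × X)) (ν ν' : Measure X), IsCoupling s ν ν' → IsFiniteMeasure s →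
      ν ≪ m → ν' ≪ m → Integrable (fun p : X × X => dist p.1 p.2 ^ 2) s := by
    intro s ν ν' hs hsf h1 h2
    apply Integrable.of_bound mdist.aestronglyMeasurable ((2 * R) ^ 2)
    filter_upwards [ac_of_coupling hs (h1.ae_le hR), ac_of_coupling' hs (h2.ae_le hR)] with p x1 x2
    rw [Real.norm_eq_abs, abs_of_nonneg (by positivity)]
    gcongr
    calc dist p.1 p.2 ≤ dist p.1 x₀ + dist p.2 x₀ := dist_triangle_right _ _ _
      _ ≤ 2 * R := by linarith
  have iq2 := id2 q μ₀ m hq inferInstance a0 Measure.AbsolutelyContinuous.rfl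
  have iπ2 := id2 π μ₀ μt hπ inferInstance a0 at'
  have intd : ∀ s : Measure (X × X), ∫ p, dist p.1 p.2 ^ 2 ∂s
      = (∫⁻ p, edist p.1 p.2 ^ 2 ∂s).toReal := by
    intro s
    rw [integral_eq_lintegral_of_nonneg_ae (ae_of_all _ fun p => by positivity)
      mdist.aestronglyMeasurable]
    simp_rw [edist_sq]
  have qd : ∫ p, dist p.1 p.2 ^ 2 ∂q = W := by rw [intd, hqc]
  have πd : ∫ p, dist p.1 p.2 ^ 2 ∂π = t ^ 2 * W := by
    rw [intd, hπc, ENNReal.toReal_mul, ENNReal.toReal_ofReal (by positivity)]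
  have bint : ∀ {Y : Type _} [MeasurableSpace Y] (s : Measure Y) [IsFiniteMeasure s] (f : Y → ℝ)
      (c : ℝ), Measurable f → (∀ y, 0 ≤ f y) → (∀ y, f y ≤ c) → Integrable f s := by
    intro Y _ s _ f c mf h0 hc
    exact Integrable.of_bound mf.aestronglyMeasurable c
      (ae_of_all _ fun y => by rw [Real.norm_eq_abs, abs_of_nonneg (h0 y)]; exact hc y)
  set A0 := ∫ x, ρ x ^ (1 - 1 / N) ∂m with hA0
  have hρφ : ∀ x, ρ x * φ x = ρ x ^ (1 - 1 / N) := by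
    intro x
    rw [hφdef, sub_eq_add_neg, Real.rpow_add (hρ0 x), Real.rpow_one]
  have φμ : ∫ x, φ x ∂μ₀ = A0 := by
    rw [int0]; simp_rw [hρφ]; rfl
  have φq : ∫ p, φ p.1 ∂q = A0 := by
    rw [← φμ, ← hq.1, integral_map measurable_fst.aemeasurable mφ.aestronglyMeasurable]
  have φπ : ∫ p, φ p.1 ∂π = A0 := by
    rw [← φμ, ← hπ.1, integral_map measurable_fst.aemeasurable mφ.aestronglyMeasurable]
  have φt : ∫ p, φ p.2 ∂π = ∫ x, φ x ∂μt := by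
    rw [← hπ.2, integral_map measurable_snd.aemeasurable mφ.aestronglyMeasurable]
  set k := K / (6 * N) with hk
  have hk0 : 0 < k := by positivity
  set c := t * ((1 - t) * (2 - t) * f0 + (1 - t ^ 2)) with hc
  have hc0 : 0 ≤ c := by
    have : t ^ 2 ≤ 1 := by nlinarith
    have h1 : 0 ≤ (1 - t) * (2 - t) * f0 :=
      mul_nonneg (mul_nonneg (by linarith) (by linarith)) hf0
    apply mul_nonneg ht0.le; linarith
  -- lower bound
  have i1 : Integrable (fun p : X × X => φ p.1) q :=
    bint q _ 2 (mφ.comp measurable_fst) (fun p => φ0 _) (fun p => φ2 _)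
  have lower : ENNReal.ofReal ((1 - t) * A0 + t + k * c * W)
      ≤ ∫⁻ p, lowInt K N t (fun x => ENNReal.ofReal (φ x)) (fun _ => 1) p ∂q := by
    have i2 : Integrable (fun p : X × X => (1 - t) * φ p.1 + t) q :=
      (i1.const_mul _).add (integrable_const _)
    have i3 : Integrable (fun p : X × X => (1 - t) * φ p.1 + t + k * c * dist p.1 p.2 ^ 2) q :=
      i2.add (iq2.const_mul _)
    have e1 : (1 - t) * A0 + t + k * c * W
        = ∫ p, ((1 - t) * φ p.1 + t + k * c * dist p.1 p.2 ^ 2) ∂q := by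
      rw [integral_add i2 (iq2.const_mul _), integral_add (i1.const_mul _) (integrable_const _),
        integral_const_mul, integral_const_mul, φq, qd]
      simp
    have nn : ∀ p : X × X, 0 ≤ (1 - t) * φ p.1 + t + k * c * dist p.1 p.2 ^ 2 := by
      intro p
      have := mul_nonneg (by linarith : 0 ≤ 1 - t) (φ0 p.1)
      have : 0 ≤ k * c * dist p.1 p.2 ^ 2 := by positivity
      linarith
    rw [e1, ofReal_integral_eq_lintegral_ofReal i3 (ae_of_all _ nn)]
    apply lintegral_mono
    intro p
    simp only [lowInt, mul_one]
    have l0 := lowCoef_nonneg (s := 1 - t) (θ := dist p.1 p.2) hK hN (by linarith) (by linarith)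
    have l1 := lowCoef_nonneg (s := t) (θ := dist p.1 p.2) hK hN (by linarith) (by linarith)
    rw [← ENNReal.ofReal_mul l0, ← ENNReal.ofReal_add (mul_nonneg l0 (φ0 _)) l1]
    apply ENNReal.ofReal_le_ofReal
    unfold lowCoef
    rw [← hk, hc]
    have hd : 0 ≤ k * dist p.1 p.2 ^ 2 := by positivity
    have hz : 0 ≤ t * (1 - t) * (2 - t) * (φ p.1 - f0) :=
      mul_nonneg (mul_nonneg (mul_nonneg ht0.le (by linarith)) (by linarith))
        (sub_nonneg.2 (hφm _))
    have := mul_nonneg hd hz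
    nlinarith
  -- upper bound
  have i1π : Integrable (fun p : X × X => φ p.1) π :=
    bint π _ 2 (mφ.comp measurable_fst) (fun p => φ0 _) (fun p => φ2 _)
  have i2π : Integrable (fun p : X × X => φ p.2) π :=
    bint π _ 2 (mφ.comp measurable_snd) (fun p => φ0 _) (fun p => φ2 _)
  have iGπ : Integrable (fun p : X × X => G p.1 ^ 2) π :=
    bint π _ (Gb ^ 2) ((mG.pow_const 2).comp measurable_fst) (fun p => by positivity)
      (fun p => pow_le_pow_left₀ (hG0 _) (hGb _) 2)
  have Gπ : ∫ p, G p.1 ^ 2 ∂π = ∫ x, G x ^ 2 * ρ x ∂m := by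
    have : ∫ p, G p.1 ^ 2 ∂π = ∫ x, G x ^ 2 ∂μ₀ := by
      rw [← hπ.1, integral_map measurable_fst.aemeasurable (mG.pow_const 2).aestronglyMeasurable]
    rw [this, int0]
    congr 1; funext x; ring
  have upper1 : ∫ x, φ x ∂μt ≤ A0 + t / (2 * β) * (∫ x, G x ^ 2 * ρ x ∂m)
      + (β / (2 * t) + B) * (t ^ 2 * W) := by
    have j1 : Integrable (fun p : X × X => φ p.1 + t / (2 * β) * G p.1 ^ 2) π :=
      i1π.add (iGπ.const_mul _)
    have j2 : Integrable (fun p : X × X => (β / (2 * t) + B) * dist p.1 p.2 ^ 2) π :=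
      iπ2.const_mul _
    have e1 : A0 + t / (2 * β) * (∫ x, G x ^ 2 * ρ x ∂m) + (β / (2 * t) + B) * (t ^ 2 * W)
        = ∫ p, (φ p.1 + t / (2 * β) * G p.1 ^ 2 + (β / (2 * t) + B) * dist p.1 p.2 ^ 2) ∂π := by
      rw [integral_add j1 j2, integral_add i1π (iGπ.const_mul _), integral_const_mul,
        integral_const_mul, φπ, πd, Gπ]
    rw [e1, ← φt]
    apply integral_mono i2π (j1.add j2)
    intro p
    have h1 := hφ p.1 p.2
    have h2 : G p.1 * dist p.1 p.2 ≤ t / (2 * β) * G p.1 ^ 2 + β / (2 * t) * dist p.1 p.2 ^ 2 := by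
      have e : t / (2 * β) * G p.1 ^ 2 + β / (2 * t) * dist p.1 p.2 ^ 2 - G p.1 * dist p.1 p.2
          = (t * G p.1 - β * dist p.1 p.2) ^ 2 / (2 * β * t) := by
        field_simp; ring
      have : 0 ≤ (t * G p.1 - β * dist p.1 p.2) ^ 2 / (2 * β * t) := by positivity
      linarith
    simp only [Pi.add_apply]
    change φ p.2 ≤ φ p.1 + G p.1 * dist p.1 p.2 + B * dist p.1 p.2 ^ 2 at h1
    linarith
  have iρa : Integrable (fun x => 1 / N * ρ x ^ (1 - 1 / N)) m := by
    apply Integrable.const_mul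
    apply bint m _ ((3 / 2) ^ (1 - 1 / N)) (mρ.pow_const _)
      (fun x => Real.rpow_nonneg (hρ0 x).le _)
      (fun x => Real.rpow_le_rpow (hρ0 x).le (hρ2 x) ha.le)
  have iφt : Integrable φ μt := bint μt _ 2 mφ φ0 φ2
  have φt0 : 0 ≤ ∫ x, φ x ∂μt := integral_nonneg φ0
  have A00 : 0 ≤ A0 := integral_nonneg fun x => Real.rpow_nonneg (hρ0 x).le _
  have upper2 : ∫⁻ x, (μt.rnDeriv m x) ^ (1 - 1/N : ℝ) ∂m
      ≤ ENNReal.ofReal (1 / N * A0 + (1 - 1 / N) * ∫ x, φ x ∂μt) := by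
    rw [ENNReal.ofReal_add (by positivity) (by positivity), ENNReal.ofReal_mul ha.le,
      ofReal_integral_eq_lintegral_ofReal iφt (ae_of_all _ φ0), hA0, ← integral_const_mul,
      ofReal_integral_eq_lintegral_ofReal iρa
        (ae_of_all _ fun x => mul_nonneg hb.le (Real.rpow_nonneg (hρ0 x).le _)),
      ← lintegral_rnDeriv_mul at' mφ.ennreal_ofReal.aemeasurable,
      ← lintegral_const_mul' _ _ ENNReal.ofReal_ne_top, ← lintegral_add_left
        (((mρ.pow_const _).const_mul _).ennreal_ofReal)]
    apply lintegral_mono_ae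
    filter_upwards [Measure.rnDeriv_lt_top μt m] with x hx
    have hs : 0 ≤ (μt.rnDeriv m x).toReal := ENNReal.toReal_nonneg
    rw [← ENNReal.ofReal_toReal hx.ne]
    generalize (μt.rnDeriv m x).toReal = s at *
    rw [ENNReal.ofReal_rpow_of_nonneg hs ha.le, ← ENNReal.ofReal_mul hs, ← ENNReal.ofReal_mul ha.le,
      ← ENNReal.ofReal_add (mul_nonneg hb.le (Real.rpow_nonneg (hρ0 x).le _))
        (mul_nonneg ha.le (mul_nonneg hs (φ0 x)))]
    apply ENNReal.ofReal_le_ofReal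
    refine (young_dens hN (hρ0 x) hs).trans (le_of_eq ?_)
    simp only [hφdef]; ring
  have tot : ENNReal.ofReal ((1 - t) * A0 + t + k * c * W)
      ≤ ENNReal.ofReal (1 / N * A0 + (1 - 1 / N) * (∫ x, φ x ∂μt) + e) := by
    rw [ENNReal.ofReal_add (by positivity) he.le]
    exact (lower.trans hcd).trans (add_le_add upper2 hδ)
  have tot' := (ENNReal.ofReal_le_ofReal_iff (by positivity)).1 tot
  have u1 := mul_le_mul_of_nonneg_left upper1 ha.le
  have e2 : (β / (2 * t) + B) * (t ^ 2 * W) = (β * t / 2 + B * t ^ 2) * W := by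
    field_simp
  have e3 : t / (2 * β) * (∫ x, G x ^ 2 * ρ x ∂m) = t * (∫ x, G x ^ 2 * ρ x ∂m) / (2 * β) := by
    ring
  rw [e2, e3] at u1
  linarith

lemma lemmaB2 {X : Type*} [MetricSpace X] [CompleteSpace X] [SecondCountableTopology X]
    [MeasurableSpace X] [BorelSpace X] {m : Measure X} [IsProbabilityMeasure m]
    {K N : ℝ} (hK : 0 < K) (hN : 1 < N)
    (hCD : CD K N m) {x₀ : X} {R : ℝ} (hR : ∀ᵐ x ∂m, dist x x₀ ≤ R)
    {ρ : X → ℝ} (mρ : Measurable ρ) (hρ1 : ∀ x, 1 / 2 ≤ ρ x) (hρ2 : ∀ x, ρ x ≤ 3 / 2)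
    (hρm : ∫ x, ρ x ∂m = 1)
    {f0 : ℝ} (hf0 : 0 ≤ f0) (hφm : ∀ x, f0 ≤ ρ x ^ (-(1 / N)))
    {G : X → ℝ} (mG : Measurable G) {Gb B : ℝ} (hG0 : ∀ x, 0 ≤ G x) (hGb : ∀ x, G x ≤ Gb)
    (hφ : ∀ x y, ρ y ^ (-(1 / N)) ≤ ρ x ^ (-(1 / N)) + G x * dist x y + B * dist x y ^ 2) :
    1 - ∫ x, ρ x ^ (1 - 1 / N) ∂m ≤
      (1 - 1 / N) ^ 2 / (4 * (K / (6 * N)) * (2 * f0 + 1)) * ∫ x, G x ^ 2 * ρ x ∂m := by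
  have hN0 : 0 < N := by linarith
  have hb : 0 < 1 / N := by positivity
  have hb1 : 1 / N < 1 := by rw [div_lt_one hN0]; exact hN
  have ha : 0 < 1 - 1 / N := by linarith
  have hρ0 : ∀ x, 0 < ρ x := fun x => lt_of_lt_of_le (by norm_num) (hρ1 x)
  have hk : 0 < K / (6 * N) := by positivity
  have hI : 0 ≤ ∫ x, G x ^ 2 * ρ x ∂m :=
    integral_nonneg fun x => mul_nonneg (sq_nonneg _) (hρ0 x).le
  by_cases hne : m.withDensity (fun x => ENNReal.ofReal (ρ x)) = m
  · have h1 : (fun x => ENNReal.ofReal (ρ x)) =ᵐ[m] fun _ => 1 := by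
      have e1 := Measure.rnDeriv_withDensity m (f := fun x => ENNReal.ofReal (ρ x))
        mρ.ennreal_ofReal
      rw [hne] at e1
      exact e1.symm.trans (Measure.rnDeriv_self m)
    have h2 : ∫ x, ρ x ^ (1 - 1 / N) ∂m = ∫ x, (1 : ℝ) ∂m := by
      apply integral_congr_ae
      filter_upwards [h1] with x hx
      have : ρ x = 1 := by
        have := congrArg ENNReal.toReal hx
        rwa [ENNReal.toReal_ofReal (hρ0 x).le, ENNReal.toReal_one] at this
      simp [this]
    rw [h2]
    simp only [integral_const, probReal_univ, smul_eq_mul, mul_one, sub_self]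
    positivity
  set W := (Wsq (m.withDensity (fun x => ENNReal.ofReal (ρ x))) m).toReal with hW
  set A0 := ∫ x, ρ x ^ (1 - 1 / N) ∂m with hA0
  set I := ∫ x, G x ^ 2 * ρ x ∂m with hIdef
  set k := K / (6 * N) with hkdef
  set a := 1 - 1 / N with hadef
  set β := 2 * k * (2 * f0 + 1) / a with hβdef
  have hβ : 0 < β := by positivity
  have key : ∀ t ∈ Ioo (0:ℝ) 1, (1 - A0) + k * ((1 - t) * (2 - t) * f0 + (1 - t ^ 2)) * W
      ≤ a * (I / (2 * β) + (β / 2 + B * t) * W) := by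
    intro t ht
    have h1 : t * (1 - A0) + k * (t * ((1 - t) * (2 - t) * f0 + (1 - t ^ 2))) * W
        ≤ a * (t * I / (2 * β) + (β * t / 2 + B * t ^ 2) * W) := by
      apply _root_.le_of_forall_pos_le_add
      intro e he
      exact lemmaB1 hK hN hCD hR mρ hρ1 hρ2 hρm hne hf0 hφm mG hG0 hGb hφ ht.1 ht.2 hβ he
    have e1 : t * (1 - A0) + k * (t * ((1 - t) * (2 - t) * f0 + (1 - t ^ 2))) * W
      = t * ((1 - A0) + k * ((1 - t) * (2 - t) * f0 + (1 - t ^ 2)) * W) := by ring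
    have e2 : a * (t * I / (2 * β) + (β * t / 2 + B * t ^ 2) * W)
      = t * (a * (I / (2 * β) + (β / 2 + B * t) * W)) := by ring
    rw [e1, e2] at h1
    exact le_of_mul_le_mul_left h1 ht.1
  have lim : (1 - A0) + k * ((1 - 0) * (2 - 0) * f0 + (1 - 0 ^ 2)) * W
      ≤ a * (I / (2 * β) + (β / 2 + B * 0) * W) := by
    have c1 : Continuous fun t : ℝ => (1 - A0) + k * ((1 - t) * (2 - t) * f0 + (1 - t ^ 2)) * W := by
      fun_prop
    have c2 : Continuous fun t : ℝ => a * (I / (2 * β) + (β / 2 + B * t) * W) := by fun_prop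
    have t1 := (c1.tendsto 0).mono_left (nhdsWithin_le_nhds (s := Ioi 0))
    have t2 := (c2.tendsto 0).mono_left (nhdsWithin_le_nhds (s := Ioi 0))
    refine le_of_tendsto_of_tendsto t1 t2 ?_
    filter_upwards [Ioo_mem_nhdsGT (zero_lt_one' ℝ)] with t ht using key t ht
  have e1 : a * (β / 2) = k * (2 * f0 + 1) := by rw [hβdef]; field_simp
  have e2 : a * (I / (2 * β)) = a ^ 2 / (4 * k * (2 * f0 + 1)) * I := by
    rw [hβdef]; field_simp; ring
  have e3 : a * (I / (2 * β) + (β / 2 + B * 0) * W)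
    = a * (I / (2 * β)) + a * (β / 2) * W := by ring
  rw [e3, e1, e2] at lim
  nlinarith

lemma rpow_quad {a v0 v : ℝ} (ha0 : 0 < a) (ha1 : a < 1) (hv0 : 0 < v0) (hv1 : v0 < 1)
    (hv : |v| ≤ v0) :
    (1 + v) ^ a ≤ 1 + a * v - a * (1 - a) / 2 * (1 + v0) ^ (a - 2) * v ^ 2 := by
  set c := a * (1 - a) * (1 + v0) ^ (a - 2) with hc
  set F : ℝ → ℝ := fun v => 1 + a * v - c / 2 * v ^ 2 - (1 + v) ^ a with hF
  have hpos : ∀ x ∈ Icc (-v0) v0, 0 < 1 + x := by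
    intro x hx
    have := hx.1
    linarith
  have d1 : ∀ x ∈ Icc (-v0) v0, HasDerivAt F (a - c * x - a * (1 + x) ^ (a - 1)) x := by
    intro x hx
    have h1 : HasDerivAt (fun v : ℝ => 1 + v) 1 x := (hasDerivAt_id x).const_add 1
    have h2 := h1.rpow_const (p := a) (Or.inl (hpos x hx).ne')
    have h3 := ((((hasDerivAt_id x).const_mul a).const_add 1).sub
      ((hasDerivAt_pow 2 x).const_mul (c / 2))).sub h2
    refine HasDerivAt.congr_deriv h3 ?_
    push_cast; ring
  have d2 : ∀ x ∈ Icc (-v0) v0, HasDerivAt (fun x => a - c * x - a * (1 + x) ^ (a - 1))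
      (a * (1 - a) * (1 + x) ^ (a - 2) - c) x := by
    intro x hx
    have h1 : HasDerivAt (fun v : ℝ => 1 + v) 1 x := (hasDerivAt_id x).const_add 1
    have h2 := (h1.rpow_const (p := a - 1) (Or.inl (hpos x hx).ne')).const_mul a
    have h3 := (((hasDerivAt_id x).const_mul c).const_sub a).sub h2
    refine HasDerivAt.congr_deriv h3 ?_
    have : a - 1 - 1 = a - 2 := by ring
    rw [this]; ring
  have hconv : ConvexOn ℝ (Icc (-v0) v0) F := by
    apply convexOn_of_hasDerivWithinAt2_nonneg (convex_Icc _ _)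
      (fun x hx => (d1 x hx).continuousAt.continuousWithinAt)
      (fun x hx => (d1 x (interior_subset hx)).hasDerivWithinAt)
      (fun x hx => (d2 x (interior_subset hx)).hasDerivWithinAt)
    intro x hx
    have hx' := interior_subset hx
    have : (1 + v0) ^ (a - 2) ≤ (1 + x) ^ (a - 2) :=
      Real.rpow_le_rpow_of_nonpos (hpos x hx') (by linarith [hx'.2]) (by linarith)
    have h0 : 0 ≤ a * (1 - a) := mul_nonneg ha0.le (by linarith)
    have := mul_le_mul_of_nonneg_left this h0
    rw [hc]; linarith
  have hF0 : F 0 = 0 := by simp [hF]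
  have h0m : (0:ℝ) ∈ Icc (-v0) v0 := ⟨by linarith, by linarith⟩
  have hD0 : HasDerivAt F 0 0 := by
    have := d1 0 h0m
    refine HasDerivAt.congr_deriv this ?_
    simp
  have hvm : v ∈ Icc (-v0) v0 := abs_le.1 hv
  have hFv : 0 ≤ F v := by
    rcases lt_trichotomy v 0 with h | h | h
    · have := hconv.slope_le_of_hasDerivAt hvm h0m h hD0
      rw [slope_def_field, hF0, div_le_iff₀ (by linarith)] at this
      linarith
    · rw [h, hF0]
    · have := hconv.le_slope_of_hasDerivAt h0m hvm h hD0
      rw [slope_def_field, hF0, le_div_iff₀ (by linarith)] at this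
      linarith
  simp only [hF, hc] at hFv
  linarith

lemma rpow_neg_diff {b m0 p s : ℝ} (hb : 0 < b) (hb1 : b < 1) (hm : 0 < m0) (hp : m0 ≤ p)
    (hs : m0 ≤ s) : p ^ (-b) ≤ s ^ (-b) + b * m0 ^ (-b - 1) * |p - s| := by
  have hp0 : 0 < p := by linarith
  have hs0 : 0 < s := by linarith
  rcases le_total s p with h | h
  · have h1 : p ^ (-b) ≤ s ^ (-b) := Real.rpow_le_rpow_of_nonpos hs0 h (by linarith)
    have : 0 ≤ b * m0 ^ (-b - 1) * |p - s| := by positivity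
    linarith
  · set w := (s - p) / p with hw
    have hw0 : 0 ≤ w := div_nonneg (by linarith) hp0.le
    have hsw : s = p * (1 + w) := by rw [hw]; field_simp; ring
    have h1 : (1 + w) ^ b ≤ 1 + b * w := rpow_one_add_le_one_add_mul_self (by linarith) hb.le hb1.le
    have h2 : 1 - b * w ≤ (1 + w) ^ (-b) := by
      rw [Real.rpow_neg (by linarith)]
      have h3 : (1 + b * w)⁻¹ ≤ ((1 + w) ^ b)⁻¹ := inv_anti₀ (by positivity) h1
      refine le_trans ?_ h3
      have hbw : 0 ≤ b * w := by positivity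
      rw [← one_div, le_div_iff₀ (by linarith)]
      nlinarith [sq_nonneg (b * w)]
    have h4 : s ^ (-b) = p ^ (-b) * (1 + w) ^ (-b) := by
      rw [hsw, Real.mul_rpow hp0.le (by linarith)]
    have h5 : p ^ (-b) * (b * w) = b * p ^ (-b - 1) * (s - p) := by
      rw [Real.rpow_sub hp0, Real.rpow_one, hw]; field_simp
    have h6 : p ^ (-b - 1) ≤ m0 ^ (-b - 1) := Real.rpow_le_rpow_of_nonpos hm hp (by linarith)
    have h7 : b * p ^ (-b - 1) * (s - p) ≤ b * m0 ^ (-b - 1) * (s - p) := by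
      have : 0 ≤ s - p := by linarith
      gcongr
    have h8 := mul_le_mul_of_nonneg_left h2 (Real.rpow_nonneg hp0.le (-b))
    rw [abs_sub_comm, abs_of_nonneg (by linarith : 0 ≤ s - p)]
    rw [h4]
    nlinarith

lemma lemmaC {X : Type*} [MetricSpace X] [CompleteSpace X] [SecondCountableTopology X]
    [MeasurableSpace X] [BorelSpace X] {m : Measure X} [IsProbabilityMeasure m]
    {K N : ℝ} (hK : 0 < K) (hN : 1 < N) (hCD : CD K N m)
    {u : X → ℝ} (mu : Measurable u) {C L r : ℝ} (hC : ∀ x, |u x| ≤ C) (hC0 : 0 < C)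
    (hmean : ∫ x, u x ∂m = 0) (hr : 0 < r)
    (hL : ∀ x y, |u y - u x| ≤ L * dist x y) (hL0 : 0 ≤ L)
    {g : X → ℝ} (mg : Measurable g) (hg0 : ∀ x, 0 ≤ g x) (hgL : ∀ x, g x ≤ L)
    (hg : ∀ x y, dist x y < r → |u y - u x| ≤ g x * dist x y) :
    ∫ x, u x ^ 2 ∂m ≤ (N - 1) / (K * N) * ∫ x, g x ^ 2 ∂m := by
  obtain ⟨x₀, R, hR⟩ := CD_bdd m K N hK hN hCD
  have hN0 : 0 < N := by linarith
  have hb : 0 < 1 / N := by positivity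
  have hb1 : 1 / N < 1 := by rw [div_lt_one hN0]; exact hN
  have ha : 0 < 1 - 1 / N := by linarith
  have iu : Integrable u m := Integrable.of_bound mu.aestronglyMeasurable C
    (ae_of_all _ fun x => by rw [Real.norm_eq_abs]; exact hC x)
  have iu2 : Integrable (fun x => u x ^ 2) m :=
    Integrable.of_bound (mu.pow_const 2).aestronglyMeasurable (C ^ 2)
    (ae_of_all _ fun x => by
      rw [Real.norm_eq_abs, abs_of_nonneg (sq_nonneg _), ← sq_abs]
      exact pow_le_pow_left₀ (abs_nonneg _) (hC x) 2)
  have ig2 : Integrable (fun x => g x ^ 2) m :=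
    Integrable.of_bound (mg.pow_const 2).aestronglyMeasurable (L ^ 2)
    (ae_of_all _ fun x => by
      rw [Real.norm_eq_abs, abs_of_nonneg (sq_nonneg _)]
      exact pow_le_pow_left₀ (hg0 x) (hgL x) 2)
  set U := ∫ x, u x ^ 2 ∂m with hU
  set Γ := ∫ x, g x ^ 2 ∂m with hΓ
  have hΓ0 : 0 ≤ Γ := integral_nonneg fun x => sq_nonneg _
  set a := 1 - 1 / N with hadef
  set k := K / (6 * N) with hkdef
  have hk : 0 < k := by positivity
  have hab : 1 - a = 1 / N := by rw [hadef]; ring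
  have key : ∀ ε ∈ Ioo (0:ℝ) (1 / (2 * C)),
      a * (1 / N) / 2 * (1 + ε * C) ^ (a - 2) * U ≤
        a ^ 2 / (4 * k * (2 * (1 + ε * C) ^ (-(1 / N)) + 1)) *
          ((1 / N * (1 - ε * C) ^ (-(1 / N) - 1)) ^ 2 * (1 + ε * C) * Γ) := by
    intro ε hε
    have hε0 : 0 < ε := hε.1
    have hεC : ε * C < 1 / 2 := by
      have := (lt_div_iff₀ (by positivity)).1 hε.2
      linarith
    have hεC0 : 0 < ε * C := by positivity
    set ρ : X → ℝ := fun x => 1 + ε * u x with hρ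
    have hv : ∀ x, |ε * u x| ≤ ε * C := by
      intro x
      rw [abs_mul, abs_of_pos hε0]
      exact mul_le_mul_of_nonneg_left (hC x) hε0.le
    have hlo : ∀ x, 1 - ε * C ≤ ρ x := fun x => by
      have := (abs_le.1 (hv x)).1
      simp only [hρ]; linarith
    have hup : ∀ x, ρ x ≤ 1 + ε * C := fun x => by
      have := (abs_le.1 (hv x)).2
      simp only [hρ]; linarith
    have hρ0 : ∀ x, 0 < ρ x := fun x => by linarith [hlo x]
    have mρ : Measurable ρ := (mu.const_mul ε).const_add 1
    set κ := 1 / N * (1 - ε * C) ^ (-(1 / N) - 1) * ε with hκ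
    have hm0 : 0 < 1 - ε * C := by linarith
    have hκ0 : 0 ≤ κ := by positivity
    have hφ : ∀ x y, ρ y ^ (-(1 / N)) ≤ ρ x ^ (-(1 / N)) + (κ * g x) * dist x y
        + (κ * L / r) * dist x y ^ 2 := by
      intro x y
      have h1 := rpow_neg_diff hb hb1 hm0 (hlo y) (hlo x)
      have h2 : |ρ y - ρ x| = ε * |u y - u x| := by
        have : ρ y - ρ x = ε * (u y - u x) := by simp only [hρ]; ring
        rw [this, abs_mul, abs_of_pos hε0]
      have h3 : 1 / N * (1 - ε * C) ^ (-(1 / N) - 1) * |ρ y - ρ x| = κ * |u y - u x| := by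
        rw [h2, hκ]; ring
      rw [h3] at h1
      have hd : 0 ≤ dist x y := dist_nonneg
      have hgx := hg0 x
      rcases lt_or_ge (dist x y) r with hlt | hge
      · have h4 := mul_le_mul_of_nonneg_left (hg x y hlt) hκ0
        have h5 : 0 ≤ (κ * L / r) * dist x y ^ 2 := by positivity
        linarith
      · have h4 := mul_le_mul_of_nonneg_left (hL x y) hκ0
        have h5 : 0 ≤ (κ * g x) * dist x y := by positivity
        have h6 : κ * (L * dist x y) ≤ (κ * L / r) * dist x y ^ 2 := by
          have e : (κ * L / r) * dist x y ^ 2 = κ * (L * dist x y) * (dist x y / r) := by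
            field_simp
          rw [e]
          exact le_mul_of_one_le_right (by positivity) ((one_le_div hr).2 hge)
        linarith
    have hrho_one : ∫ x, ρ x ∂m = 1 := by
      simp only [hρ]
      rw [integral_add (integrable_const _) (iu.const_mul _), integral_const_mul, hmean]
      simp
    have B2 := lemmaB2 hK hN hCD hR mρ (fun x => by linarith [hlo x]) (fun x => by linarith [hup x])
      hrho_one (f0 := (1 + ε * C) ^ (-(1 / N))) (by positivity)
      (fun x => Real.rpow_le_rpow_of_nonpos (hρ0 x) (hup x) (by linarith))
      (mg.const_mul κ) (Gb := κ * L) (fun x => mul_nonneg hκ0 (hg0 x))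
      (fun x => mul_le_mul_of_nonneg_left (hgL x) hκ0) hφ
    have i1 : Integrable (fun x => 1 + a * (ε * u x)) m :=
      (integrable_const _).add ((iu.const_mul _).const_mul _)
    have i2 : Integrable (fun x => a * (1 / N) / 2 * (1 + ε * C) ^ (a - 2) * ε ^ 2 * u x ^ 2) m :=
      iu2.const_mul _
    have A0le : ∫ x, ρ x ^ a ∂m ≤ 1 - a * (1 / N) / 2 * (1 + ε * C) ^ (a - 2) * ε ^ 2 * U := by
      have e1 : 1 - a * (1 / N) / 2 * (1 + ε * C) ^ (a - 2) * ε ^ 2 * U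
          = ∫ x, (1 + a * (ε * u x) - a * (1 / N) / 2 * (1 + ε * C) ^ (a - 2) * ε ^ 2 * u x ^ 2) ∂m := by
        rw [integral_sub i1 i2, integral_add (integrable_const _) ((iu.const_mul _).const_mul _),
          integral_const_mul, integral_const_mul, integral_const_mul, hmean]
        simp only [integral_const, probReal_univ, smul_eq_mul, mul_zero, add_zero, mul_one, hU]
      rw [e1]
      apply integral_mono _ (i1.sub i2)
      · intro x
        have := rpow_quad (a := a) ha (by linarith) hεC0 (by linarith) (hv x)
        rw [hab] at this
        simp only [Pi.sub_apply, hρ]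
        linarith
      · apply Integrable.of_bound (mρ.pow_const a).aestronglyMeasurable ((1 + ε * C) ^ a)
        refine ae_of_all _ fun x => ?_
        rw [Real.norm_eq_abs, abs_of_nonneg (Real.rpow_nonneg (hρ0 x).le _)]
        exact Real.rpow_le_rpow (hρ0 x).le (hup x) ha.le
    have Ile : ∫ x, (κ * g x) ^ 2 * ρ x ∂m ≤ κ ^ 2 * (1 + ε * C) * Γ := by
      rw [hΓ, ← integral_const_mul]
      have hle : ∀ x, (κ * g x) ^ 2 * ρ x ≤ κ ^ 2 * (1 + ε * C) * g x ^ 2 := by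
        intro x
        calc (κ * g x) ^ 2 * ρ x ≤ (κ * g x) ^ 2 * (1 + ε * C) :=
              mul_le_mul_of_nonneg_left (hup x) (sq_nonneg _)
          _ = _ := by ring
      exact integral_mono_of_nonneg (ae_of_all _ fun x => mul_nonneg (sq_nonneg _) (hρ0 x).le)
        (ig2.const_mul _) (ae_of_all _ hle)
    have hcoef : 0 ≤ a ^ 2 / (4 * k * (2 * (1 + ε * C) ^ (-(1 / N)) + 1)) := by positivity
    have fin := mul_le_mul_of_nonneg_left Ile hcoef
    have tot : a * (1 / N) / 2 * (1 + ε * C) ^ (a - 2) * ε ^ 2 * U ≤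
        a ^ 2 / (4 * k * (2 * (1 + ε * C) ^ (-(1 / N)) + 1)) * (κ ^ 2 * (1 + ε * C) * Γ) := by
      linarith
    have hε2 : 0 < ε ^ 2 := by positivity
    refine le_of_mul_le_mul_left ?_ hε2
    refine le_trans (le_of_eq ?_) (tot.trans (le_of_eq ?_))
    · ring
    · rw [hκ]; ring
  have lim : a * (1 / N) / 2 * (1 + 0 * C) ^ (a - 2) * U ≤
        a ^ 2 / (4 * k * (2 * (1 + 0 * C) ^ (-(1 / N)) + 1)) *
          ((1 / N * (1 - 0 * C) ^ (-(1 / N) - 1)) ^ 2 * (1 + 0 * C) * Γ) := by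
    have cp : ContinuousAt (fun ε : ℝ => 1 + ε * C) 0 := by fun_prop
    have cm : ContinuousAt (fun ε : ℝ => 1 - ε * C) 0 := by fun_prop
    have p1 : ContinuousAt (fun ε : ℝ => (1 + ε * C) ^ (a - 2)) 0 :=
      cp.rpow_const (Or.inl (by simp))
    have p2 : ContinuousAt (fun ε : ℝ => (1 + ε * C) ^ (-(1 / N))) 0 :=
      cp.rpow_const (Or.inl (by simp))
    have p3 : ContinuousAt (fun ε : ℝ => (1 - ε * C) ^ (-(1 / N) - 1)) 0 :=
      cm.rpow_const (Or.inl (by simp))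
    have c1 : ContinuousAt (fun ε : ℝ => a * (1 / N) / 2 * (1 + ε * C) ^ (a - 2) * U) 0 :=
      (continuousAt_const.mul p1).mul continuousAt_const
    have c2 : ContinuousAt (fun ε : ℝ => a ^ 2 / (4 * k * (2 * (1 + ε * C) ^ (-(1 / N)) + 1)) *
          ((1 / N * (1 - ε * C) ^ (-(1 / N) - 1)) ^ 2 * (1 + ε * C) * Γ)) 0 := by
      refine ContinuousAt.mul (ContinuousAt.div continuousAt_const
        (continuousAt_const.mul ((continuousAt_const.mul p2).add continuousAt_const)) ?_)
        ((((continuousAt_const.mul p3).pow 2).mul cp).mul continuousAt_const)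
      simp only [zero_mul, add_zero, Real.one_rpow]
      positivity
    have t1 := c1.tendsto.mono_left (nhdsWithin_le_nhds (s := Ioi 0))
    have t2 := c2.tendsto.mono_left (nhdsWithin_le_nhds (s := Ioi 0))
    refine le_of_tendsto_of_tendsto t1 t2 ?_
    filter_upwards [Ioo_mem_nhdsGT (show (0:ℝ) < 1 / (2 * C) by positivity)] with ε hε using key ε hε
  simp only [zero_mul, add_zero, sub_zero, Real.one_rpow, mul_one] at lim
  have e1 : a ^ 2 / (4 * k * (2 + 1)) * ((1 / N) ^ 2 * Γ)
      = a * (1 / N) / 2 * ((N - 1) / (K * N) * Γ) := by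
    rw [hkdef, hadef]; field_simp; ring
  rw [e1] at lim
  exact le_of_mul_le_mul_left lim (by positivity)

/-- difference quotient restricted to a punctured ball -/
def quotR {X : Type*} [MetricSpace X] (u : X → ℝ) (r : ℝ) (x y : X) : ℝ :=
  if 0 < dist y x ∧ dist y x < r then |u y - u x| / dist y x else 0

/-- Lipschitz constant at scale `r` -/
def lipR {X : Type*} [MetricSpace X] (u : X → ℝ) (r : ℝ) (x : X) : ℝ := ⨆ y, quotR u r x y

section lipR
variable {X : Type*} [MetricSpace X] {u : X → ℝ} {L : ℝ}

lemma quotR_nonneg (r : ℝ) (x y : X) : 0 ≤ quotR u r x y := by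
  unfold quotR
  split_ifs
  · positivity
  · exact le_rfl

lemma quotR_le (hL0 : 0 ≤ L) (hL : ∀ x y, |u y - u x| ≤ L * dist x y) (r : ℝ) (x y : X) :
    quotR u r x y ≤ L := by
  unfold quotR
  split_ifs with h
  · rw [div_le_iff₀ h.1, dist_comm]; exact hL x y
  · exact hL0

lemma quotR_bdd (hL0 : 0 ≤ L) (hL : ∀ x y, |u y - u x| ≤ L * dist x y) (r : ℝ) (x : X) :
    BddAbove (range (quotR u r x)) := ⟨L, by rintro _ ⟨y, rfl⟩; exact quotR_le hL0 hL r x y⟩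

lemma lipR_nonneg (r : ℝ) (x : X) : 0 ≤ lipR u r x :=
  Real.iSup_nonneg fun y => quotR_nonneg r x y

lemma lipR_le (hL0 : 0 ≤ L) (hL : ∀ x y, |u y - u x| ≤ L * dist x y) (r : ℝ) (x : X) :
    lipR u r x ≤ L := Real.iSup_le (fun y => quotR_le hL0 hL r x y) hL0

lemma lipR_spec (hL0 : 0 ≤ L) (hL : ∀ x y, |u y - u x| ≤ L * dist x y) {r : ℝ} {x y : X}
    (h : dist x y < r) : |u y - u x| ≤ lipR u r x * dist x y := by
  rcases eq_or_ne x y with rfl | hne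
  · simp
  · have hd : 0 < dist y x := dist_pos.2 hne.symm
    have h1 : quotR u r x y ≤ lipR u r x := le_ciSup (quotR_bdd hL0 hL r x) y
    unfold quotR at h1
    rw [if_pos ⟨hd, by rwa [dist_comm]⟩, div_le_iff₀ hd, dist_comm] at h1
    exact h1

lemma lipR_mono (hL0 : 0 ≤ L) (hL : ∀ x y, |u y - u x| ≤ L * dist x y) {r s : ℝ} (hrs : r ≤ s)
    (x : X) : lipR u r x ≤ lipR u s x := by
  apply ciSup_mono (quotR_bdd hL0 hL s x)
  intro y
  by_cases h : 0 < dist y x ∧ dist y x < r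
  · unfold quotR
    rw [if_pos h, if_pos ⟨h.1, h.2.trans_le hrs⟩]
  · have : quotR u r x y = 0 := by unfold quotR; rw [if_neg h]
    rw [this]; exact quotR_nonneg s x y

lemma meas_lipR [MeasurableSpace X] [BorelSpace X] (hu : Continuous u)
    (hL0 : 0 ≤ L) (hL : ∀ x y, |u y - u x| ≤ L * dist x y) (r : ℝ) :
    Measurable (lipR u r) := by
  apply measurable_of_Ioi
  intro c
  rcases lt_or_ge c 0 with hc | hc
  · have : lipR u r ⁻¹' Ioi c = univ := by
      ext x; simp only [mem_preimage, mem_Ioi, mem_univ, iff_true]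
      exact hc.trans_le (lipR_nonneg r x)
    rw [this]; exact MeasurableSet.univ
  · have : lipR u r ⁻¹' Ioi c = ⋃ y, {x | 0 < dist y x ∧ dist y x < r ∧
        c * dist y x < |u y - u x|} := by
      ext x
      simp only [mem_preimage, mem_Ioi, mem_iUnion, mem_setOf_eq]
      have : Nonempty X := ⟨x⟩
      unfold lipR
      rw [lt_ciSup_iff (quotR_bdd hL0 hL r x)]
      constructor
      · rintro ⟨y, hy⟩
        refine ⟨y, ?_⟩
        unfold quotR at hy
        split_ifs at hy with h
        · exact ⟨h.1, h.2, (lt_div_iff₀ h.1).1 hy⟩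
        · linarith
      · rintro ⟨y, h1, h2, h3⟩
        refine ⟨y, ?_⟩
        unfold quotR
        rw [if_pos ⟨h1, h2⟩]
        exact (lt_div_iff₀ h1).2 h3
    rw [this]
    apply IsOpen.measurableSet
    apply isOpen_iUnion
    intro y
    have cd : Continuous fun x => dist y x := by fun_prop
    have o1 : IsOpen {x | 0 < dist y x} := isOpen_lt continuous_const cd
    have o2 : IsOpen {x | dist y x < r} := isOpen_lt cd continuous_const
    have o3 : IsOpen {x | c * dist y x < |u y - u x|} :=
      isOpen_lt (by fun_prop) (by fun_prop)
    exact o1.inter (o2.inter o3)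

lemma iInf_lipR_le (hL0 : 0 ≤ L) (hL : ∀ x y, |u y - u x| ≤ L * dist x y) (x : X) :
    ⨅ n : ℕ, lipR u (1 / ((n : ℝ) + 1)) x ≤ lipSlope u x := by
  have bdd : BddBelow (range fun n : ℕ => lipR u (1 / ((n : ℝ) + 1)) x) :=
    ⟨0, by rintro _ ⟨n, rfl⟩; exact lipR_nonneg _ x⟩
  have key : ∀ a : ℝ, 0 ≤ a → (∀ᶠ y in 𝓝[≠] x, |u y - u x| / dist y x ≤ a) →
      ⨅ n : ℕ, lipR u (1 / ((n : ℝ) + 1)) x ≤ a := by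
    intro a ha hev
    obtain ⟨ε, hε, hball⟩ := Metric.mem_nhdsWithin_iff.1 hev
    obtain ⟨n, hn⟩ := exists_nat_one_div_lt hε
    refine (ciInf_le bdd n).trans ?_
    apply Real.iSup_le _ ha
    intro y
    unfold quotR
    split_ifs with h
    · exact hball ⟨Metric.mem_ball.2 (h.2.trans hn), dist_pos.1 h.1⟩
    · exact ha
  unfold lipSlope
  rw [limsup_eq]
  change _ ≤ sInf {a | ∀ᶠ y in 𝓝[≠] x, |u y - u x| / dist y x ≤ a}
  by_cases hb : (𝓝[≠] x) = ⊥
  · have : {a : ℝ | ∀ᶠ y in 𝓝[≠] x, |u y - u x| / dist y x ≤ a} = univ := by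
      ext a; simp [hb]
    rw [this, Real.sInf_univ]
    exact key 0 le_rfl (by simp [hb])
  · have hne : (𝓝[≠] x).NeBot := ⟨hb⟩
    apply le_csInf
    · refine ⟨L, ?_⟩
      filter_upwards [self_mem_nhdsWithin] with y hy
      have hd : 0 < dist y x := dist_pos.2 hy
      rw [div_le_iff₀ hd, dist_comm]; exact hL x y
    · intro a ha
      have ha2 : ∀ᶠ y in 𝓝[≠] x, |u y - u x| / dist y x ≤ a := ha
      obtain ⟨y, hy⟩ := ha2.exists
      exact key a (le_trans (by positivity) hy) ha2

end lipR

lemma main_aux {X : Type*} [MetricSpace X] [CompleteSpace X] [SecondCountableTopology X]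
    [MeasurableSpace X] [BorelSpace X] (m : Measure X) [IsProbabilityMeasure m]
    (K N : ℝ) (hK : 0 < K) (hN : 1 < N) (hCD : CD K N m)
    (u : X → ℝ) (hbd : ∃ C, ∀ x, |u x| ≤ C) (hlip : ∃ L, LipschitzWith L u)
    (hmean : ∫ x, u x ∂m = 0) :
    ∫⁻ x, ENNReal.ofReal (u x ^ 2) ∂m ≤
      ENNReal.ofReal ((N - 1) / (K * N)) * ∫⁻ x, ENNReal.ofReal (lipSlope u x ^ 2) ∂m := by
  obtain ⟨C, hC⟩ := hbd
  obtain ⟨L, hLip⟩ := hlip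
  have hu : Continuous u := hLip.continuous
  have hL0 : (0:ℝ) ≤ L := L.2
  have hL : ∀ x y, |u y - u x| ≤ (L:ℝ) * dist x y := by
    intro x y
    have := hLip.dist_le_mul y x
    rwa [Real.dist_eq, dist_comm] at this
  have hC' : ∀ x, |u x| ≤ |C| + 1 := fun x => (hC x).trans (by linarith [le_abs_self C])
  have hc : 0 ≤ (N - 1) / (K * N) := by
    have : 0 < N - 1 := by linarith
    positivity
  set g : ℕ → X → ℝ := fun n => lipR u (1 / ((n : ℝ) + 1)) with hg
  have mg : ∀ n, Measurable (g n) := fun n => meas_lipR hu hL0 hL _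
  have g0 : ∀ n x, 0 ≤ g n x := fun n x => lipR_nonneg _ x
  have gL : ∀ n x, g n x ≤ L := fun n x => lipR_le hL0 hL _ x
  have step : ∀ n, ∫⁻ x, ENNReal.ofReal (u x ^ 2) ∂m ≤
      ENNReal.ofReal ((N - 1) / (K * N)) * ∫⁻ x, ENNReal.ofReal (g n x ^ 2) ∂m := by
    intro n
    have h := lemmaC hK hN hCD hu.measurable (C := |C| + 1) (L := L) (r := 1 / ((n : ℝ) + 1)) hC'
      (by positivity) hmean (by positivity) hL hL0 (mg n) (g0 n) (gL n)
      (fun x y hxy => lipR_spec hL0 hL hxy)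
    have iu2 : Integrable (fun x => u x ^ 2) m :=
      Integrable.of_bound (hu.measurable.pow_const 2).aestronglyMeasurable ((|C| + 1) ^ 2)
      (ae_of_all _ fun x => by
        rw [Real.norm_eq_abs, abs_of_nonneg (sq_nonneg _), ← sq_abs]
        exact pow_le_pow_left₀ (abs_nonneg _) (hC' x) 2)
    have ig2 : Integrable (fun x => g n x ^ 2) m :=
      Integrable.of_bound ((mg n).pow_const 2).aestronglyMeasurable ((L:ℝ) ^ 2)
      (ae_of_all _ fun x => by
        rw [Real.norm_eq_abs, abs_of_nonneg (sq_nonneg _)]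
        exact pow_le_pow_left₀ (g0 n x) (gL n x) 2)
    rw [← ofReal_integral_eq_lintegral_ofReal iu2 (ae_of_all _ fun x => sq_nonneg _),
      ← ofReal_integral_eq_lintegral_ofReal ig2 (ae_of_all _ fun x => sq_nonneg _),
      ← ENNReal.ofReal_mul hc]
    exact ENNReal.ofReal_le_ofReal h
  have lim : Tendsto (fun n => ∫⁻ x, ENNReal.ofReal (g n x ^ 2) ∂m) atTop
      (𝓝 (∫⁻ x, ENNReal.ofReal ((⨅ n, g n x) ^ 2) ∂m)) := by
    apply tendsto_lintegral_of_dominated_convergence (fun _ => ENNReal.ofReal ((L:ℝ) ^ 2))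
      (fun n => ((mg n).pow_const 2).ennreal_ofReal)
    · intro n
      refine ae_of_all _ fun x => ENNReal.ofReal_le_ofReal ?_
      exact pow_le_pow_left₀ (g0 n x) (gL n x) 2
    · simp
    · refine ae_of_all _ fun x => ?_
      apply ENNReal.tendsto_ofReal
      apply Filter.Tendsto.pow
      apply tendsto_atTop_ciInf
      · intro i j hij
        apply lipR_mono hL0 hL
        have : (i:ℝ) ≤ j := by exact_mod_cast hij
        gcongr
      · exact ⟨0, by rintro _ ⟨n, rfl⟩; exact g0 n x⟩
  have h1 := ge_of_tendsto' (ENNReal.Tendsto.const_mul lim (Or.inr ENNReal.ofReal_ne_top)) step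
  refine h1.trans ?_
  gcongr with x
  · exact le_ciInf fun n => g0 n x
  · exact iInf_lipR_le hL0 hL x

/-- **Poincaré/Lichnerowicz inequality** under CD(K,N) with `K > 0`, `1 < N < ∞`:
`λ₁ ≥ KN/(N-1)`. -/
theorem lichnerowicz_poincare
    {X : Type*} [MetricSpace X] [CompleteSpace X] [TopologicalSpace.SeparableSpace X]
    [MeasurableSpace X] [BorelSpace X] (m : Measure X) [IsProbabilityMeasure m]
    (K N : ℝ) (hK : 0 < K) (hN : 1 < N) (hCD : CD K N m)
    (u : X → ℝ) (hbd : ∃ C, ∀ x, |u x| ≤ C) (hlip : ∃ L, LipschitzWith L u)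
    (hmean : ∫ x, u x ∂m = 0) :
    ∫⁻ x, ENNReal.ofReal (u x ^ 2) ∂m ≤
      ENNReal.ofReal ((N - 1) / (K * N)) * ∫⁻ x, ENNReal.ofReal (lipSlope u x ^ 2) ∂m := by
  have : SecondCountableTopology X := UniformSpace.secondCountable_of_separable X
  exact main_aux m K N hK hN hCD u hbd hlip hmean

end
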